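/- Assume the completion conjecture. Let Γ be a reducible completed primitive graph. Then for every vertex v of Γ and every prime power q, [X_{Γ∖v}]_q ≡ 0 (mod q³); that is, the c2-invariant c2(Γ∖v)_q vanishes modulo q. -/

import Mathlib

open scoped Classical
open Matrix

/-- The graph polynomial (Kirchhoff polynomial) of a finite simple graph `G`:
`Ψ_G = Σ_T Π_{e ∉ T} x_e`, summed over spanning trees `T` of `G`. -/
noncomputable def graphPoly {V : Type*} [Fintype V] (G : SimpleGraph V) :
    MvPolynomial G.edgeSet ℤ :=
  letI : Fintype G.edgeSet := Fintype.ofFinite _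
  ∑ T : Finset G.edgeSet,
    if (SimpleGraph.fromEdgeSet (Subtype.val '' (T : Set G.edgeSet))).IsTree then
      ∏ e ∈ Tᶜ, MvPolynomial.X e
    else 0

/-- `[X_G]_q`: the number of points `x ∈ K^{E(G)}` with `Ψ_G(x) = 0`. -/
noncomputable def Xcount {V : Type*} [Fintype V] (G : SimpleGraph V)
    (K : Type*) [CommRing K] : ℕ :=
  Nat.card {x : G.edgeSet → K // MvPolynomial.aeval x (graphPoly G) = 0}

/-- A connected 4-regular simple graph with at least 5 vertices is completed primitive if
removing any 4 edges leaves it either connected or with an isolated vertex. -/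
def IsCompletedPrimitive {W : Type*} [Fintype W] (Γ : SimpleGraph W) : Prop :=
  Γ.Connected ∧ (∀ w : W, Nat.card (Γ.neighborSet w) = 4) ∧ 5 ≤ Fintype.card W ∧
  ∀ C : Set (Sym2 W), C ⊆ Γ.edgeSet → Nat.card C = 4 →
    (Γ.deleteEdges C).Connected ∨ ∃ w : W, ∀ u : W, ¬ (Γ.deleteEdges C).Adj w u

/-- `Γ ∖ v`: delete the vertex `v` and all incident edges. -/
def delVert {W : Type*} (Γ : SimpleGraph W) (v : W) : SimpleGraph ↥{u : W | u ≠ v} :=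
  SimpleGraph.induce {u : W | u ≠ v} Γ

/-- A graph is reducible if it becomes disconnected after removing some three vertices. -/
def IsReducible {W : Type*} (Γ : SimpleGraph W) : Prop :=
  ∃ v₁ v₂ v₃ : W, v₁ ≠ v₂ ∧ v₁ ≠ v₃ ∧ v₂ ≠ v₃ ∧
    ¬ (SimpleGraph.induce {u : W | u ≠ v₁ ∧ u ≠ v₂ ∧ u ≠ v₃} Γ).Connected

/-- The completion conjecture: point counts of `Γ ∖ v` modulo `q³` do not depend on `v`. -/
def CompletionConjecture : Prop :=
  ∀ (W : Type) [Fintype W] (Γ : SimpleGraph W), IsCompletedPrimitive Γ →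
    ∀ (v w : W) (K : Type) [Field K] [Fintype K],
      Xcount (delVert Γ v) K ≡ Xcount (delVert Γ w) K [MOD (Fintype.card K) ^ 3]

set_option linter.unusedSectionVars false
set_option linter.unusedSimpArgs false
section MatrixTree

variable {V E : Type} [Fintype V] [Fintype E]

/-- reduced incidence matrix -/
noncomputable def incM (F : Type) [CommRing F] (s t : E → V) (a : V) : Matrix E V F :=
  Matrix.of fun e v => if v = a then 0 else (if v = s e then 1 else 0) - (if v = t e then 1 else 0)

/-- skew network matrix -/
noncomputable def skewM (F : Type) [CommRing F] (s t : E → V) (a : V) (x : E → F) : Matrix (E ⊕ V) (E ⊕ V) F :=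
  Matrix.fromBlocks (Matrix.diagonal x) (incM F s t a) (-(incM F s t a)ᵀ)
    (Matrix.diagonal fun v => if v = a then 1 else 0)

/-- the matrix for a subset of edges -/
noncomputable def treeM (F : Type) [CommRing F] (s t : E → V) (a : V) (T : Finset E) :
    Matrix (E ⊕ V) (E ⊕ V) F :=
  Matrix.fromBlocks (Matrix.diagonal fun e => if e ∈ T then 0 else 1)
    (Matrix.of fun e v => if e ∈ T then incM F s t a e v else 0) (-(incM F s t a)ᵀ)
    (Matrix.diagonal fun v => if v = a then 1 else 0)

lemma det_skewM_expand (F : Type) [CommRing F] (s t : E → V) (a : V) (x : E → F) :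
    (skewM F s t a x).det = ∑ T : Finset E, (∏ e ∈ Tᶜ, x e) * (treeM F s t a T).det := by
  let f := (MultilinearMap.currySum
    (Matrix.detRowAlternating (n := E ⊕ V) (R := F)).toMultilinearMap)
  let vr : V → (E ⊕ V → F) := fun v => skewM F s t a x (Sum.inr v)
  let m : E → (E ⊕ V → F) := fun e => Pi.single (Sum.inl e) 1
  let m' : E → (E ⊕ V → F) := fun e => Sum.elim 0 (incM F s t a e)
  have h1 : (skewM F s t a x).det = f ((fun e => x e • m e) + m') vr := by
    change Matrix.det _ = Matrix.det _
    congr 1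
    ext i j
    rcases i with e | v
    · rcases j with e' | v'
      · simp [skewM, m, m', Pi.single_apply, Matrix.diagonal_apply, eq_comm]
      · simp [skewM, m, m', Pi.single_apply]
    · rfl
  rw [h1, MultilinearMap.map_add_univ, _root_.sum_apply]
  refine Fintype.sum_equiv (Equiv.mk (fun S : Finset E => Sᶜ) (fun S : Finset E => Sᶜ) compl_compl compl_compl) _ _ ?_
  intro S
  simp only [Equiv.coe_fn_mk, compl_compl]
  have h2 : S.piecewise (fun e => x e • m e) m'
      = S.piecewise (fun e => x e • (S.piecewise m m') e) (S.piecewise m m') := by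
    ext e j
    by_cases he : e ∈ S <;> simp [he]
  rw [h2, MultilinearMap.map_piecewise_smul, _root_.smul_apply, smul_eq_mul]
  congr 1
  change Matrix.det _ = Matrix.det _
  congr 1
  ext i j
  rcases i with e | v
  · rcases j with e' | v'
    · by_cases he : e ∈ S <;>
        simp [treeM, m, m', he, Pi.single_apply, Matrix.diagonal_apply, eq_comm]
    · by_cases he : e ∈ S <;> simp [treeM, m, m', he, Pi.single_apply]
  · rfl

/-- the graph spanned by a set of edges -/
def spanG (s t : E → V) (T : Finset E) : SimpleGraph V :=
  SimpleGraph.fromEdgeSet ((fun e => s(s e, t e)) '' (T : Set E))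

lemma incM_mulVec (F : Type) [CommRing F] (s t : E → V) (a : V) (h : V → F) (e : E) :
    (incM F s t a *ᵥ h) e = (if s e = a then 0 else h (s e)) - (if t e = a then 0 else h (t e)) := by
  simp only [Matrix.mulVec, dotProduct, incM, Matrix.of_apply]
  have : ∀ v, (if v = a then (0:F) else (if v = s e then 1 else 0) - (if v = t e then 1 else 0)) * h v
      = (if v = s e then (if v = a then 0 else h v) else 0) -
        (if v = t e then (if v = a then 0 else h v) else 0) := by
    intro v; split_ifs <;> simp
  simp [this, Finset.sum_sub_distrib]

lemma spanG_const {F : Type} (s t : E → V) (T : Finset E) (g : V → F)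
    (hg : ∀ e ∈ T, g (s e) = g (t e)) {u v : V} (h : (spanG s t T).Reachable u v) : g u = g v := by
  obtain ⟨w⟩ := h
  induction w with
  | nil => rfl
  | cons hadj _ ih =>
    rw [← ih]
    simp only [spanG, SimpleGraph.fromEdgeSet_adj, Set.mem_image, Finset.mem_coe] at hadj
    obtain ⟨⟨e, he, h2⟩, -⟩ := hadj
    rcases Sym2.eq_iff.1 h2 with ⟨h3, h4⟩ | ⟨h3, h4⟩
    · rw [← h3, ← h4]; exact hg e he
    · rw [← h3, ← h4]; exact (hg e he).symm

lemma treeM_mulVec_eq_zero (F : Type) [Field F] (s t : E → V) (a : V) (T : Finset E)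
    (z : E → F) (h : V → F) :
    treeM F s t a T *ᵥ (Sum.elim z h) = 0 ↔ (∀ e ∉ T, z e = 0) ∧
      (∀ e ∈ T, (incM F s t a *ᵥ h) e = 0) ∧ h a = 0 ∧ (z ᵥ* incM F s t a = 0) := by
  have hcol : (z ᵥ* incM F s t a) a = 0 := by
    simp [Matrix.vecMul, dotProduct, incM]
  have hE : ∀ e, (treeM F s t a T *ᵥ (Sum.elim z h)) (Sum.inl e) =
      if e ∈ T then (incM F s t a *ᵥ h) e else z e := by
    intro e
    rw [treeM, Matrix.fromBlocks_mulVec]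
    simp only [Sum.elim_inl, Pi.add_apply, Sum.elim_comp_inl, Sum.elim_comp_inr,
      Matrix.mulVec_diagonal]
    by_cases he : e ∈ T
    · simp [he, Matrix.mulVec, dotProduct]
    · simp [he, Matrix.mulVec, dotProduct]
  have hV : ∀ v, (treeM F s t a T *ᵥ (Sum.elim z h)) (Sum.inr v) =
      -(z ᵥ* incM F s t a) v + if v = a then h a else 0 := by
    intro v
    rw [treeM, Matrix.fromBlocks_mulVec]
    simp only [Sum.elim_inr, Pi.add_apply, Sum.elim_comp_inl, Sum.elim_comp_inr,
      Matrix.mulVec_diagonal, Matrix.neg_mulVec, Matrix.mulVec_transpose, Pi.neg_apply]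
    by_cases hv : v = a
    · simp [hv]
    · simp [hv]
  constructor
  · intro H
    refine ⟨fun e he => ?_, fun e he => ?_, ?_, ?_⟩
    · have := hE e; rw [H] at this; simpa [he] using this.symm
    · have := hE e; rw [H] at this; simpa [he] using this.symm
    · have := hV a; rw [H] at this; simpa [hcol] using this.symm
    · ext v
      by_cases hv : v = a
      · rw [hv, hcol]; rfl
      · have := hV v; rw [H] at this; simpa [hv] using this.symm
  · rintro ⟨h1, h2, h3, h4⟩
    ext (e | v)
    · rw [hE]; split_ifs with he
      · exact h2 e he
      · exact h1 e he
    · rw [hV, h4, h3]; simp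

lemma spanG_card (s t : E → V) (hst : ∀ e, s e ≠ t e)
    (hinj : Function.Injective fun e => s(s e, t e)) (T : Finset E) :
    Nat.card (spanG s t T).edgeSet = T.card := by
  have : (spanG s t T).edgeSet = (fun e => s(s e, t e)) '' (T : Set E) := by
    rw [spanG, SimpleGraph.edgeSet_fromEdgeSet]
    apply sdiff_eq_left.2
    rw [Set.disjoint_left]
    rintro _ ⟨e, he, rfl⟩ h
    simp at h
    exact hst e h
  rw [this, Nat.card_image_of_injective hinj]
  simp

lemma treeM_det_ne_zero (F : Type) [Field F] (s t : E → V) (hst : ∀ e, s e ≠ t e)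
    (hinj : Function.Injective fun e => s(s e, t e)) (a : V) (T : Finset E) :
    (treeM F s t a T).det ≠ 0 ↔ (spanG s t T).IsTree := by
  rw [SimpleGraph.isTree_iff_connected_and_card, spanG_card s t hst hinj]
  constructor
  · intro H
    have H' : ∀ w : E ⊕ V → F, treeM F s t a T *ᵥ w = 0 → w = 0 := by
      intro w hw; by_contra hne
      exact H (Matrix.exists_mulVec_eq_zero_iff.1 ⟨w, hne, hw⟩)
    have hconn : (spanG s t T).Connected := by
      have : Nonempty V := ⟨a⟩
      suffices h : ∀ v, (spanG s t T).Reachable a v from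
        ⟨fun u v => (h u).symm.trans (h v)⟩
      intro v
      by_contra hv
      let h : V → F := fun u => if (spanG s t T).Reachable a u then 0 else 1
      have := H' (Sum.elim 0 h) ((treeM_mulVec_eq_zero F s t a T 0 h).2
        ⟨fun _ _ => rfl, fun e he => ?_, ?_, by simp⟩)
      · have := congrFun this (Sum.inr v)
        simp [h, hv] at this
      · have hadj : (spanG s t T).Adj (s e) (t e) := by
          simp only [spanG, SimpleGraph.fromEdgeSet_adj]
          exact ⟨⟨e, he, rfl⟩, hst e⟩
        have hr : (spanG s t T).Reachable a (s e) ↔ (spanG s t T).Reachable a (t e) :=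
          ⟨fun h => h.trans hadj.reachable, fun h => h.trans hadj.reachable.symm⟩
        have h0 : h a = 0 := by simp [h]
        have hx : ∀ u, (if u = a then 0 else h u) = h u := by
          intro u; split_ifs with hu
          · rw [hu, h0]
          · rfl
        rw [incM_mulVec, hx, hx]
        simp [h, hr]
      · simp [h]
    refine ⟨hconn, ?_⟩
    have h1 := hconn.card_vert_le_card_edgeSet_add_one
    rw [spanG_card s t hst hinj] at h1
    by_contra hne
    have hlt : Nat.card V < T.card + 1 := lt_of_le_of_ne h1 (fun h => hne h.symm)
    -- nontrivial kernel
    let L : (T → F) →ₗ[F] ({v : V // v ≠ a} → F) :=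
      { toFun := fun y v => ((fun e => if h : e ∈ T then y ⟨e, h⟩ else 0) ᵥ* incM F s t a) v
        map_add' := by
          intro y y'
          ext v
          simp only [Pi.add_apply]
          rw [← Pi.add_apply, ← Matrix.add_vecMul]
          congr 2
          ext e
          by_cases he : e ∈ T <;> simp [he]
        map_smul' := by
          intro c y
          ext v
          simp only [Pi.smul_apply, RingHom.id_apply]
          rw [← Pi.smul_apply, ← Matrix.smul_vecMul]
          congr 2
          ext e
          by_cases he : e ∈ T <;> simp [he] }
    have hcv : Fintype.card {v : V // v ≠ a} + 1 = Fintype.card V := by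
      have := Fintype.card_subtype_compl (fun v : V => v = a)
      simp only [Fintype.card_unique] at this
      have hp : 0 < Fintype.card V := Fintype.card_pos_iff.2 ⟨a⟩
      simp only [ne_eq]
      omega
    have hk : LinearMap.ker L ≠ ⊥ := by
      apply LinearMap.ker_ne_bot_of_finrank_lt
      simp only [Module.finrank_fintype_fun_eq_card, Fintype.card_coe]
      rw [Nat.card_eq_fintype_card] at hlt
      omega
    obtain ⟨y, hy, hy0⟩ := Submodule.exists_mem_ne_zero_of_ne_bot hk
    apply hy0
    let z : E → F := fun e => if h : e ∈ T then y ⟨e, h⟩ else 0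
    have := H' (Sum.elim z 0) ((treeM_mulVec_eq_zero F s t a T z 0).2
      ⟨fun e he => by simp [z, he], fun e he => by simp, rfl, ?_⟩)
    · ext ⟨e, he⟩
      have := congrFun this (Sum.inl e)
      simpa [z, he] using this
    · ext v
      by_cases hv : v = a
      · simp [hv, Matrix.vecMul, dotProduct, incM]
      · exact congrFun (LinearMap.mem_ker.1 hy) ⟨v, hv⟩
  · rintro ⟨hconn, hcard⟩ H
    obtain ⟨w, hw0, hw⟩ := Matrix.exists_mulVec_eq_zero_iff.2 H
    obtain ⟨z, h, rfl⟩ : ∃ z h, w = Sum.elim z h :=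
      ⟨w ∘ Sum.inl, w ∘ Sum.inr, (Sum.elim_comp_inl_inr w).symm⟩
    obtain ⟨h1, h2, h3, h4⟩ := (treeM_mulVec_eq_zero F s t a T z h).1 hw
    have key : ∀ h : V → F, h a = 0 → (∀ e ∈ T, (incM F s t a *ᵥ h) e = 0) → h = 0 := by
      intro h h3 h2
      ext v
      have hx : ∀ u, (if u = a then 0 else h u) = h u := by
        intro u; split_ifs with hu
        · rw [hu, h3]
        · rfl
      rw [← spanG_const s t T h (fun e he => ?_) (hconn.preconnected a v), h3]; · rfl
      have := h2 e he
      rw [incM_mulVec, hx, hx] at this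
      exact sub_eq_zero.1 this
    have hh : h = 0 := key h h3 h2
    subst hh
    apply hw0
    have hz : z = 0 := by
      let L : ({v : V // v ≠ a} → F) →ₗ[F] (T → F) :=
        { toFun := fun y e => (incM F s t a *ᵥ (fun v => if h : v ≠ a then y ⟨v, h⟩ else 0)) e
          map_add' := by
            intro y y'
            ext e
            simp only [Pi.add_apply]
            rw [← Pi.add_apply, ← Matrix.mulVec_add]
            congr 2
            ext v
            by_cases he : v = a <;> simp [he]
          map_smul' := by
            intro c y
            ext e
            simp only [Pi.smul_apply, RingHom.id_apply]
            rw [← Pi.smul_apply, ← Matrix.mulVec_smul]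
            congr 2
            ext v
            by_cases he : v = a <;> simp [he] }
      have hcv : Fintype.card {v : V // v ≠ a} + 1 = Fintype.card V := by
        have := Fintype.card_subtype_compl (fun v : V => v = a)
        simp only [Fintype.card_unique] at this
        have hp : 0 < Fintype.card V := Fintype.card_pos_iff.2 ⟨a⟩
        simp only [ne_eq]
        omega
      have hinjL : Function.Injective L := by
        rw [injective_iff_map_eq_zero]
        intro y hy
        have := key (fun v => if h : v ≠ a then y ⟨v, h⟩ else 0) (by simp)
          (fun e he => congrFun hy ⟨e, he⟩)
        ext ⟨v, hv⟩
        simpa [hv] using congrFun this v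
      have hsurj : Function.Surjective L := by
        refine (LinearMap.injective_iff_surjective_of_finrank_eq_finrank ?_).1 hinjL
        simp only [Module.finrank_fintype_fun_eq_card, Fintype.card_coe]
        rw [Nat.card_eq_fintype_card] at hcard
        omega
      ext e
      by_cases he : e ∈ T
      · obtain ⟨y, hy⟩ := hsurj (Pi.single ⟨e, he⟩ 1)
        have h5 : z ⬝ᵥ (incM F s t a *ᵥ (fun v => if h : v ≠ a then y ⟨v, h⟩ else 0)) = 0 := by
          rw [Matrix.dotProduct_mulVec, h4, zero_dotProduct]
        rw [dotProduct, Finset.sum_eq_single e] at h5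
        · have h6 := congrFun hy ⟨e, he⟩
          simp only [Pi.single_eq_same] at h6
          change (incM F s t a *ᵥ (fun v => if h : v ≠ a then y ⟨v, h⟩ else 0)) e = 1 at h6
          rw [h6, mul_one] at h5
          exact h5
        · intro e' _ hne
          by_cases he' : e' ∈ T
          · have h6 := congrFun hy ⟨e', he'⟩
            change (incM F s t a *ᵥ (fun v => if h : v ≠ a then y ⟨v, h⟩ else 0)) e' = _ at h6
            rw [h6, Pi.single_eq_of_ne, mul_zero]
            simpa using hne
          · rw [h1 e' he', zero_mul]
        · simp
      · exact h1 e he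
    subst hz
    ext (e | v) <;> rfl

end MatrixTree
section MatrixTree2

variable {V E : Type} [Fintype V] [Fintype E]

lemma treeM_map {F F' : Type} [CommRing F] [CommRing F'] (f : F →+* F') (s t : E → V) (a : V)
    (T : Finset E) : (treeM F s t a T).map f = treeM F' s t a T := by
  ext (e | v) (e' | v')
  · simp [treeM, Matrix.diagonal_apply, apply_ite f]
  · simp only [treeM, incM, Matrix.map_apply, Matrix.fromBlocks_apply₁₂, Matrix.of_apply]
    split_ifs <;> simp
  · simp only [treeM, incM, Matrix.map_apply, Matrix.fromBlocks_apply₂₁, Matrix.of_apply,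
      Matrix.neg_apply, Matrix.transpose_apply]
    split_ifs <;> simp
  · simp [treeM, Matrix.diagonal_apply, apply_ite f]

lemma treeM_det_nonneg (s t : E → V) (a : V) (T : Finset E) (hT : (treeM ℝ s t a T).det ≠ 0) :
    0 ≤ (treeM ℝ s t a T).det := by
  let DS : Matrix E E ℝ := Matrix.diagonal fun e => if e ∈ T then 0 else 1
  let DT : Matrix E E ℝ := Matrix.diagonal fun e => if e ∈ T then 1 else 0
  let B := incM ℝ s t a
  let C : Matrix E V ℝ := DT * B
  let D : Matrix V V ℝ := Matrix.diagonal fun v => if v = a then 1 else 0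
  have hDSt : DSᵀ = DS := Matrix.diagonal_transpose _
  have hDTt : DTᵀ = DT := Matrix.diagonal_transpose _
  have hDSS : DS * DS = DS := by simp [DS, Matrix.diagonal_mul_diagonal]
  have hDST : DS * DT = 0 := by
    ext e e'
    by_cases he : e ∈ T
    · simp [DS, DT, Matrix.diagonal_apply, he]
    · by_cases h : e = e'
      · subst h; simp [DS, DT, Matrix.diagonal_apply, he]
      · simp [DS, DT, Matrix.diagonal_apply, h]
  have hadd : DS + DT = 1 := by
    ext e e'
    by_cases he : e ∈ T <;> simp [DS, DT, Matrix.diagonal_apply, he, Matrix.one_apply]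
  have hBD : B * D = 0 := by
    ext e v
    by_cases hv : v = a <;> simp [B, D, incM, hv]
  have hDB : D * Cᵀ = 0 := by
    have : (C * D)ᵀ = 0 := by simp [C, Matrix.mul_assoc, hBD]
    rwa [Matrix.transpose_mul, Matrix.diagonal_transpose] at this
  have hA : treeM ℝ s t a T = Matrix.fromBlocks DS C (-Bᵀ) D := by
    ext (e | v) (e' | v')
    · rfl
    · simp [treeM, C, DT, B]
    · rfl
    · rfl
  have hA1 : treeM ℝ s t a T
      = Matrix.fromBlocks 1 0 (-(Bᵀ * DS)) 1 * Matrix.fromBlocks DS C (-Cᵀ) D := by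
    rw [hA, Matrix.fromBlocks_multiply]
    congr 1
    · simp
    · simp
    · have : Bᵀ = Bᵀ * (DS + DT) := by rw [hadd, Matrix.mul_one]
      simp only [Matrix.one_mul, Matrix.neg_mul, Matrix.mul_assoc, hDSS, C, Matrix.transpose_mul,
        hDTt]
      conv_lhs => rw [this, Matrix.mul_add]
      rw [neg_add]
    · simp [C, ← Matrix.mul_assoc, Matrix.mul_assoc Bᵀ DS DT, hDST]
  have hdet1 : (treeM ℝ s t a T).det = (Matrix.fromBlocks DS C (-Cᵀ) D).det := by
    rw [hA1, Matrix.det_mul, Matrix.det_fromBlocks_zero₁₂]; simp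
  let P : Matrix E E ℝ := DS + C * Cᵀ
  have hdet2 : (Matrix.fromBlocks DS C (-Cᵀ) D).det = (Matrix.fromBlocks P C (-Cᵀ) D).det := by
    have : Matrix.fromBlocks P C (-Cᵀ) D
        = Matrix.fromBlocks DS C (-Cᵀ) D * Matrix.fromBlocks 1 0 Cᵀ 1 := by
      rw [Matrix.fromBlocks_multiply]
      simp [P, hDB]
    rw [this, Matrix.det_mul, Matrix.det_fromBlocks_zero₁₂]; simp
  have hDSp : DS.PosSemidef := by
    apply Matrix.PosSemidef.diagonal
    intro e; dsimp; split_ifs <;> simp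
  have hDp : D.PosSemidef := by
    apply Matrix.PosSemidef.diagonal
    intro e; dsimp; split_ifs <;> simp
  have hCC : (C * Cᵀ).PosSemidef := by
    have := Matrix.posSemidef_self_mul_conjTranspose C
    simpa using this
  have hP : P.PosSemidef := hDSp.add hCC
  have hPd : P.det ≠ 0 := by
    intro h0
    obtain ⟨z, hz0, hz⟩ := Matrix.exists_mulVec_eq_zero_iff.2 h0
    have h1 : z ⬝ᵥ (DS *ᵥ z) + z ⬝ᵥ ((C * Cᵀ) *ᵥ z) = 0 := by
      rw [← dotProduct_add, ← Matrix.add_mulVec]; simp [P] at hz; rw [hz]; simp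
    have h2 : z ⬝ᵥ (DS *ᵥ z) = (DS *ᵥ z) ⬝ᵥ (DS *ᵥ z) := by
      conv_lhs => rw [← hDSS, ← Matrix.mulVec_mulVec, Matrix.dotProduct_mulVec,
        ← Matrix.mulVec_transpose, hDSt]
    have h3 : z ⬝ᵥ ((C * Cᵀ) *ᵥ z) = (Cᵀ *ᵥ z) ⬝ᵥ (Cᵀ *ᵥ z) := by
      rw [← Matrix.mulVec_mulVec, Matrix.dotProduct_mulVec, ← Matrix.mulVec_transpose]
    have nn : ∀ {n : Type} [Fintype n] (y : n → ℝ), 0 ≤ y ⬝ᵥ y := fun y =>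
      Finset.sum_nonneg fun i _ => mul_self_nonneg _
    rw [h2, h3] at h1
    have h4 : (DS *ᵥ z) ⬝ᵥ (DS *ᵥ z) = 0 := by
      have := nn (DS *ᵥ z); have := nn (Cᵀ *ᵥ z); linarith
    have h5 : (Cᵀ *ᵥ z) ⬝ᵥ (Cᵀ *ᵥ z) = 0 := by
      have := nn (DS *ᵥ z); have := nn (Cᵀ *ᵥ z); linarith
    rw [dotProduct_self_eq_zero] at h4 h5
    apply hT
    rw [hdet1]
    apply Matrix.exists_mulVec_eq_zero_iff.1
    refine ⟨Sum.elim z 0, ?_, ?_⟩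
    · intro h; apply hz0; ext e; exact congrFun h (Sum.inl e)
    · rw [Matrix.fromBlocks_mulVec]
      simp [h4, h5, Matrix.neg_mulVec]
  have : Invertible P := P.invertibleOfIsUnitDet (isUnit_iff_ne_zero.2 hPd)
  rw [hdet1, hdet2, Matrix.det_fromBlocks₁₁]
  apply mul_nonneg hP.det_nonneg
  apply Matrix.PosSemidef.det_nonneg
  have h6 : D - -Cᵀ * ⅟P * C = D + Cᵀ * P⁻¹ * C := by
    simp [Matrix.invOf_eq_nonsing_inv]
  rw [h6]
  apply hDp.add
  have := (hP.inv).conjTranspose_mul_mul_same C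
  simpa using this

lemma treeM_det_int (s t : E → V) (hst : ∀ e, s e ≠ t e)
    (hinj : Function.Injective fun e => s(s e, t e)) (a : V) (T : Finset E) :
    (treeM ℤ s t a T).det = if (spanG s t T).IsTree then 1 else 0 := by
  have hcast : ∀ (F : Type) [CommRing F], (treeM F s t a T).det = ((treeM ℤ s t a T).det : F) := by
    intro F _
    rw [← treeM_map (Int.castRingHom F), ← RingHom.mapMatrix_apply, ← RingHom.map_det]
    simp
  have hF := fun (F : Type) [Field F] => treeM_det_ne_zero F s t hst hinj a T
  split_ifs with h
  · have hne : ∀ (p : ℕ), p.Prime → ¬ p ∣ (treeM ℤ s t a T).det.natAbs := by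
      intro p hp hd
      have : Fact p.Prime := ⟨hp⟩
      have h1 := (hF (ZMod p)).2 h
      rw [hcast] at h1
      apply h1
      rw [ZMod.intCast_zmod_eq_zero_iff_dvd]
      exact Int.natCast_dvd.2 hd
    have h1 : (treeM ℤ s t a T).det.natAbs = 1 := by
      by_contra hh
      obtain ⟨p, hp, hd⟩ := Nat.exists_prime_and_dvd hh
      exact hne p hp hd
    have h2 := treeM_det_nonneg s t a T ((hF ℝ).2 h)
    rw [hcast ℝ] at h2
    have h3 : 0 ≤ (treeM ℤ s t a T).det := by exact_mod_cast h2
    omega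
  · have h1 := mt (hF ℚ).1 h
    rw [hcast ℚ] at h1
    simpa using h1

lemma det_skewM_eq (F : Type) [CommRing F] (s t : E → V) (hst : ∀ e, s e ≠ t e)
    (hinj : Function.Injective fun e => s(s e, t e)) (a : V) (x : E → F) :
    (skewM F s t a x).det =
      ∑ T : Finset E, if (spanG s t T).IsTree then (∏ e ∈ Tᶜ, x e) else 0 := by
  rw [det_skewM_expand]
  refine Finset.sum_congr rfl fun T _ => ?_
  rw [← treeM_map (Int.castRingHom F), ← RingHom.mapMatrix_apply, ← RingHom.map_det,
    treeM_det_int s t hst hinj]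
  split_ifs <;> simp

/-- symmetric network matrix -/
noncomputable def symM (F : Type) [CommRing F] (s t : E → V) (a : V) (x : E → F) :
    Matrix (E ⊕ V) (E ⊕ V) F :=
  Matrix.fromBlocks (Matrix.diagonal x) (incM F s t a) (incM F s t a)ᵀ
    (-Matrix.diagonal fun v => if v = a then 1 else 0)

lemma symM_det_eq_zero (F : Type) [Field F] (s t : E → V) (a : V) (x : E → F) :
    (symM F s t a x).det = 0 ↔ (skewM F s t a x).det = 0 := by
  have : symM F s t a x = Matrix.fromBlocks 1 0 0 (-1) * skewM F s t a x := by
    simp [symM, skewM, Matrix.fromBlocks_multiply]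
  rw [this, Matrix.det_mul, Matrix.det_fromBlocks_zero₁₂]
  simp [Matrix.det_neg]

/-- the network is singular -/
def netSing (F : Type) [CommRing F] (s t : E → V) (a : V) (x : E → F) : Prop :=
  (symM F s t a x).det = 0

lemma netSing_iff (F : Type) [Field F] (s t : E → V) (hst : ∀ e, s e ≠ t e)
    (hinj : Function.Injective fun e => s(s e, t e)) (a : V) (x : E → F) :
    netSing F s t a x ↔
      (∑ T : Finset E, if (spanG s t T).IsTree then (∏ e ∈ Tᶜ, x e) else 0) = 0 := by
  rw [netSing, symM_det_eq_zero, det_skewM_eq F s t hst hinj]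

end MatrixTree2

lemma graphPoly_zero_iff {V : Type} [Fintype V] (G : SimpleGraph V) (K : Type) [Field K]
    (s t : G.edgeSet → V) (hst : ∀ e, s(s e, t e) = (e : Sym2 V)) (a : V) (x : G.edgeSet → K) :
    MvPolynomial.aeval x (graphPoly G) = 0 ↔
      @netSing _ _ _ (Fintype.ofFinite _) K _ s t a x := by
  have h1 : ∀ e, s e ≠ t e := by
    intro e h
    have := e.2
    rw [← hst e, SimpleGraph.mem_edgeSet] at this
    exact this.ne h
  have h2 : Function.Injective fun e => s(s e, t e) := by
    simp only [hst]; exact Subtype.val_injective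
  rw [@netSing_iff _ _ _ (Fintype.ofFinite _) K _ s t h1 h2]
  have : MvPolynomial.aeval x (graphPoly G) =
      letI : Fintype G.edgeSet := Fintype.ofFinite _
      ∑ T : Finset G.edgeSet, if (spanG s t T).IsTree then (∏ e ∈ Tᶜ, x e) else 0 := by
    rw [graphPoly, map_sum]
    refine Finset.sum_congr rfl fun T _ => ?_
    have h3 : SimpleGraph.fromEdgeSet (Subtype.val '' (T : Set G.edgeSet)) = spanG s t T := by
      simp only [spanG, hst]
    rw [h3]
    split_ifs
    · simp [map_prod]
    · simp
  rw [this]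
  convert! Iff.rfl
section Counting

lemma natcard_prod_sum {α β : Type} [Fintype α] [Fintype β] (P : α × β → Prop) :
    Nat.card {p : α × β // P p} = ∑ a, Nat.card {b : β // P (a, b)} := by
  simp only [Nat.card_eq_fintype_card]
  rw [← Fintype.card_sigma]
  exact Fintype.card_congr
    { toFun := fun p => ⟨p.1.1, ⟨p.1.2, p.2⟩⟩
      invFun := fun p => ⟨(p.1, p.2.1), p.2.2⟩
      left_inv := fun p => rfl
      right_inv := fun p => rfl }

variable {K : Type} [Field K] [Fintype K]

lemma count_shift (P : K → K → K → Prop)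
    (h : ∀ b c, ∃ d, ∀ a, P a b c ↔ P (a + d) 0 0) :
    (Fintype.card K) ^ 2 ∣ Nat.card {p : (K × K) × K // P p.2 p.1.1 p.1.2} := by
  rw [natcard_prod_sum (fun p : (K × K) × K => P p.2 p.1.1 p.1.2)]
  have : ∀ y : K × K, Nat.card {a : K // P a y.1 y.2} = Nat.card {a : K // P a 0 0} := by
    intro y
    obtain ⟨d, hd⟩ := h y.1 y.2
    apply Nat.card_congr
    exact (Equiv.addRight d).subtypeEquiv hd
  simp only [this]
  simp [Fintype.card_prod, pow_two]

lemma count_quadric (s u w : K) :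
    (Fintype.card K) ^ 2 ∣
      Nat.card {p : K × (K × K) // (p.1 - s) * (p.2.1 - u) - (p.2.2 - w) * (p.2.2 - w) = 0} := by
  rw [natcard_prod_sum (fun p : K × (K × K) =>
    (p.1 - s) * (p.2.1 - u) - (p.2.2 - w) * (p.2.2 - w) = 0)]
  have : ∀ a : K, Nat.card {y : K × K // (a - s) * (y.1 - u) - (y.2 - w) * (y.2 - w) = 0}
      = Fintype.card K := by
    intro a
    rw [← Nat.card_eq_fintype_card]
    by_cases ha : a = s
    · exact Nat.card_congr
        { toFun := fun y => y.1.1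
          invFun := fun b => ⟨(b, w), by simp [ha]⟩
          left_inv := by
            rintro ⟨⟨b, c⟩, h⟩
            simp only [ha, sub_self, zero_mul, zero_sub, neg_eq_zero, mul_self_eq_zero] at h
            simp [sub_eq_zero.1 h]
          right_inv := fun b => rfl }
    · have ha' : a - s ≠ 0 := sub_ne_zero.2 ha
      exact Nat.card_congr
        { toFun := fun y => y.1.2
          invFun := fun c => ⟨((c - w) * (c - w) / (a - s) + u, c), by
            simp only [add_sub_cancel_right]; field_simp; ring⟩
          left_inv := by
            rintro ⟨⟨b, c⟩, h⟩
            simp only [Subtype.mk.injEq, Prod.mk.injEq, and_true]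
            simp only at h
            rw [← sub_eq_zero.1 h]
            field_simp
            ring
          right_inv := fun b => rfl }
  simp only [this]
  simp [pow_two]

variable {J : Type} [Fintype J]

lemma det_shift (S : Matrix (Fin 2) (Fin 2) K) (U : Matrix (Fin 2) J K) (R : Matrix J J K)
    (hR : Rᵀ = R) (k : J → K) (hk : R *ᵥ k = 0) (e e' : Fin 2 → K) :
    (Matrix.fromBlocks (S + Matrix.vecMulVec (U *ᵥ k) e + Matrix.vecMulVec e' (U *ᵥ k))
      U Uᵀ R).det = (Matrix.fromBlocks S U Uᵀ R).det := by
  have hk' : k ᵥ* R = 0 := by rw [← Matrix.mulVec_transpose, hR, hk]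
  have h1 : Matrix.fromBlocks (S + Matrix.vecMulVec (U *ᵥ k) e + Matrix.vecMulVec e' (U *ᵥ k))
      U Uᵀ R = Matrix.fromBlocks 1 (Matrix.vecMulVec e' k) 0 1 * Matrix.fromBlocks S U Uᵀ R *
        Matrix.fromBlocks 1 0 (Matrix.vecMulVec k e) 1 := by
    have hv : Matrix.vecMulVec e' (0 : J → K) = 0 := by ext; simp [Matrix.vecMulVec_apply]
    rw [Matrix.fromBlocks_multiply, Matrix.fromBlocks_multiply]
    simp only [hv, Matrix.one_mul, Matrix.mul_one, Matrix.zero_mul, Matrix.mul_zero, zero_add,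
      add_zero, Matrix.vecMulVec_mul, hk', Matrix.vecMulVec_zero, Matrix.mul_vecMulVec, hk,
      Matrix.zero_vecMulVec]
    congr 1
    rw [Matrix.vecMul_transpose]
    abel
  rw [h1, Matrix.det_mul, Matrix.det_mul, Matrix.det_fromBlocks_zero₂₁,
    Matrix.det_fromBlocks_zero₁₂]
  simp

lemma core_count (U : Matrix (Fin 2) J K) (R : Matrix J J K) (hR : Rᵀ = R) :
    (Fintype.card K) ^ 2 ∣ Nat.card {p : K × (K × K) //
      (Matrix.fromBlocks !![p.1, p.2.2; p.2.2, p.2.1] U Uᵀ R).det = 0} := by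
  by_cases hd : R.det = 0
  · obtain ⟨k, hk0, hk⟩ := Matrix.exists_mulVec_eq_zero_iff.2 hd
    by_cases h1 : (U *ᵥ k) 1 = 0
    · by_cases h0 : (U *ᵥ k) 0 = 0
      · have : ∀ p : K × (K × K),
            (Matrix.fromBlocks !![p.1, p.2.2; p.2.2, p.2.1] U Uᵀ R).det = 0 := by
          intro p
          apply Matrix.exists_mulVec_eq_zero_iff.1
          refine ⟨Sum.elim 0 k, ?_, ?_⟩
          · intro h; apply hk0; ext e; exact congrFun h (Sum.inr e)
          · have hw : U *ᵥ k = 0 := by ext i; fin_cases i <;> simp [h0, h1]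
            rw [Matrix.fromBlocks_mulVec]
            simp [hw, hk]
        simp only [this]
        simp only [Nat.card_eq_fintype_card, Fintype.card_subtype_true, Fintype.card_prod]
        exact ⟨Fintype.card K, by ring⟩
      · have := count_shift (K := K) (fun b a c =>
          (Matrix.fromBlocks !![a, c; c, b] U Uᵀ R).det = 0) (by
            intro a c
            set w := U *ᵥ k with hw
            let e : Fin 2 → K := ![- a / w 0, - c / w 0]
            let e' : Fin 2 → K := ![0, (- c + w 1 * a / w 0) / w 0]
            refine ⟨w 1 * (e 1 + e' 1), fun b => ?_⟩
            rw [← det_shift !![a, c; c, b] U R hR k hk e e', ← hw]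
            have : !![a, c; c, b] + vecMulVec w e + vecMulVec e' w
                = !![0, 0; 0, b + w 1 * (e 1 + e' 1)] := by
              ext i j
              rw [Matrix.add_apply, Matrix.add_apply, Matrix.vecMulVec_apply,
                Matrix.vecMulVec_apply]
              fin_cases i <;> fin_cases j <;>
                simp [e, e'] <;> field_simp <;> ring
            rw [this])
        refine this.trans (dvd_of_eq (Nat.card_congr (Equiv.subtypeEquiv
          { toFun := fun p => (p.1.1, (p.2, p.1.2))
            invFun := fun p => ((p.1, p.2.2), p.2.1)
            left_inv := fun _ => rfl
            right_inv := fun _ => rfl } (fun p => Iff.rfl))))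
    · have := count_shift (K := K) (fun a b c =>
          (Matrix.fromBlocks !![a, c; c, b] U Uᵀ R).det = 0) (by
            intro b c
            set w := U *ᵥ k with hw
            let e : Fin 2 → K := ![- c / w 1, - b / w 1]
            let e' : Fin 2 → K := ![(- c + w 0 * b / w 1) / w 1, 0]
            refine ⟨w 0 * (e 0 + e' 0), fun a => ?_⟩
            rw [← det_shift !![a, c; c, b] U R hR k hk e e', ← hw]
            have : !![a, c; c, b] + vecMulVec w e + vecMulVec e' w
                = !![a + w 0 * (e 0 + e' 0), 0; 0, 0] := by
              ext i j
              rw [Matrix.add_apply, Matrix.add_apply, Matrix.vecMulVec_apply,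
                Matrix.vecMulVec_apply]
              fin_cases i <;> fin_cases j <;>
                simp [e, e'] <;> field_simp <;> ring
            rw [this])
      refine this.trans (dvd_of_eq (Nat.card_congr (Equiv.subtypeEquiv
          { toFun := fun p => (p.2, p.1)
            invFun := fun p => (p.2, p.1)
            left_inv := fun _ => rfl
            right_inv := fun _ => rfl } (fun p => Iff.rfl))))
  · have : Invertible R := R.invertibleOfIsUnitDet (isUnit_iff_ne_zero.2 hd)
    let S := U * ⅟R * Uᵀ
    have hS : Sᵀ = S := by
      simp only [S, Matrix.invOf_eq_nonsing_inv, Matrix.transpose_mul, Matrix.transpose_transpose,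
        Matrix.transpose_nonsing_inv, hR, Matrix.mul_assoc]
    have hS' : S 1 0 = S 0 1 := congrFun (congrFun hS 0) 1
    refine (count_quadric (S 0 0) (S 1 1) (S 0 1)).trans (dvd_of_eq (Nat.card_congr
      (Equiv.subtypeEquiv (Equiv.refl _) (fun p => ?_))))
    rw [Matrix.det_fromBlocks₂₂, mul_eq_zero, or_iff_right hd]
    change _ ↔ Matrix.det (!![p.1, p.2.2; p.2.2, p.2.1] - S) = 0
    rw [Matrix.det_fin_two]
    simp [hS']

lemma star_det (x σ : Fin 3 → K) (hσ : ∀ i, σ i * σ i = 1) (Q : Matrix (Fin 4) J K)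
    (hQ : ∀ j, Q 3 j = 0) (R : Matrix J J K) :
    (Matrix.fromBlocks !![x 0, 0, 0, σ 0; 0, x 1, 0, σ 1; 0, 0, x 2, σ 2; σ 0, σ 1, σ 2, 0]
      Q Qᵀ R).det = 0 ↔
    (Matrix.fromBlocks !![x 0 + x 2, x 2; x 2, x 1 + x 2]
      (Matrix.of ![fun j => σ 0 * Q 0 j - σ 2 * Q 2 j, fun j => σ 1 * Q 1 j - σ 2 * Q 2 j])
      (Matrix.of ![fun j => σ 0 * Q 0 j - σ 2 * Q 2 j, fun j => σ 1 * Q 1 j - σ 2 * Q 2 j])ᵀ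
        R).det = 0 := by
  rw [← Matrix.exists_mulVec_eq_zero_iff, ← Matrix.exists_mulVec_eq_zero_iff]
  have e1 : ∀ (y : Fin 4 → K) (z : J → K),
    (Matrix.fromBlocks !![x 0, 0, 0, σ 0; 0, x 1, 0, σ 1; 0, 0, x 2, σ 2; σ 0, σ 1, σ 2, 0]
      Q Qᵀ R) *ᵥ Sum.elim y z = 0 ↔
      (x 0 * y 0 + σ 0 * y 3 + Q 0 ⬝ᵥ z = 0 ∧ x 1 * y 1 + σ 1 * y 3 + Q 1 ⬝ᵥ z = 0 ∧
       x 2 * y 2 + σ 2 * y 3 + Q 2 ⬝ᵥ z = 0 ∧ σ 0 * y 0 + σ 1 * y 1 + σ 2 * y 2 = 0 ∧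
       ∀ j, Q 0 j * y 0 + Q 1 j * y 1 + Q 2 j * y 2 + (R *ᵥ z) j = 0) := by
    intro y z
    have hQz : Q 3 ⬝ᵥ z = 0 := by simp [dotProduct, hQ]
    rw [Matrix.fromBlocks_mulVec, funext_iff, Sum.forall]
    simp only [Sum.elim_comp_inl, Sum.elim_comp_inr, Sum.elim_inl, Sum.elim_inr]
    rw [Fin.forall_fin_succ, Fin.forall_fin_succ, Fin.forall_fin_succ, Fin.forall_fin_succ]
    simp [Matrix.mulVec, dotProduct, Fin.sum_univ_four, hQ, and_assoc] at hQz ⊢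
  have e2 : ∀ (y : Fin 2 → K) (z : J → K),
    (Matrix.fromBlocks !![x 0 + x 2, x 2; x 2, x 1 + x 2]
      (Matrix.of ![fun j => σ 0 * Q 0 j - σ 2 * Q 2 j, fun j => σ 1 * Q 1 j - σ 2 * Q 2 j])
      (Matrix.of ![fun j => σ 0 * Q 0 j - σ 2 * Q 2 j, fun j => σ 1 * Q 1 j - σ 2 * Q 2 j])ᵀ
        R) *ᵥ Sum.elim y z = 0 ↔
      ((x 0 + x 2) * y 0 + x 2 * y 1 + (σ 0 * (Q 0 ⬝ᵥ z) - σ 2 * (Q 2 ⬝ᵥ z)) = 0 ∧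
       x 2 * y 0 + (x 1 + x 2) * y 1 + (σ 1 * (Q 1 ⬝ᵥ z) - σ 2 * (Q 2 ⬝ᵥ z)) = 0 ∧
       ∀ j, (σ 0 * Q 0 j - σ 2 * Q 2 j) * y 0 + (σ 1 * Q 1 j - σ 2 * Q 2 j) * y 1
         + (R *ᵥ z) j = 0) := by
    intro y z
    rw [Matrix.fromBlocks_mulVec, funext_iff, Sum.forall]
    simp only [Sum.elim_comp_inl, Sum.elim_comp_inr, Sum.elim_inl, Sum.elim_inr]
    rw [Fin.forall_fin_succ, Fin.forall_fin_succ]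
    simp [Matrix.mulVec, dotProduct, Fin.sum_univ_two, and_assoc, Finset.mul_sum, sub_mul,
      mul_assoc, Finset.sum_sub_distrib]
  have s0 := hσ 0
  have s1 := hσ 1
  have s2 := hσ 2
  have hs0 : σ 0 ≠ 0 := by rintro h; simp [h] at s0
  have hs1 : σ 1 ≠ 0 := by rintro h; simp [h] at s1
  have hs2 : σ 2 ≠ 0 := by rintro h; simp [h] at s2
  constructor
  · rintro ⟨w, hw0, hw⟩
    obtain ⟨y, z, rfl⟩ : ∃ y z, w = Sum.elim y z :=
      ⟨w ∘ Sum.inl, w ∘ Sum.inr, (Sum.elim_comp_inl_inr w).symm⟩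
    obtain ⟨h0, h1, h2, h3, h4⟩ := (e1 y z).1 hw
    refine ⟨Sum.elim ![σ 0 * y 0, σ 1 * y 1] z, ?_, ?_⟩
    · intro h
      apply hw0
      have hy0 : σ 0 * y 0 = 0 := congrFun h (Sum.inl 0)
      have hy1 : σ 1 * y 1 = 0 := congrFun h (Sum.inl 1)
      have hz : z = 0 := by ext j; exact congrFun h (Sum.inr j)
      have hy0 : y 0 = 0 := by simpa [hs0] using hy0
      have hy1 : y 1 = 0 := by simpa [hs1] using hy1
      have hy2 : y 2 = 0 := by simpa [hy0, hy1, hs2] using h3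
      have hy3 : y 3 = 0 := by simpa [hy0, hz, hs0] using h0
      ext (i | j)
      · fin_cases i <;> simp [hy0, hy1, hy2, hy3]
      · simp [hz]
    · rw [e2]
      simp only [Matrix.cons_val_zero, Matrix.cons_val_one]
      refine ⟨?_, ?_, fun j => ?_⟩
      · linear_combination σ 0 * h0 - σ 2 * h2 + x 2 * h3 - y 3 * s0 + y 3 * s2
      · linear_combination σ 1 * h1 - σ 2 * h2 + x 2 * h3 - y 3 * s1 + y 3 * s2
      · linear_combination h4 j + Q 0 j * y 0 * s0 + Q 1 j * y 1 * s1 + Q 2 j * y 2 * s2 -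
          Q 2 j * σ 2 * h3
  · rintro ⟨w, hw0, hw⟩
    obtain ⟨y, z, rfl⟩ : ∃ y z, w = Sum.elim y z :=
      ⟨w ∘ Sum.inl, w ∘ Sum.inr, (Sum.elim_comp_inl_inr w).symm⟩
    obtain ⟨h0, h1, h4⟩ := (e2 y z).1 hw
    refine ⟨Sum.elim ![σ 0 * y 0, σ 1 * y 1, - σ 2 * (y 0 + y 1),
      x 2 * (y 0 + y 1) - σ 2 * (Q 2 ⬝ᵥ z)] z, ?_, ?_⟩
    · intro h
      apply hw0
      have hy0 : σ 0 * y 0 = 0 := congrFun h (Sum.inl 0)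
      have hy1 : σ 1 * y 1 = 0 := congrFun h (Sum.inl 1)
      have hz : z = 0 := by ext j; exact congrFun h (Sum.inr j)
      have hy0 : y 0 = 0 := by simpa [hs0] using hy0
      have hy1 : y 1 = 0 := by simpa [hs1] using hy1
      ext (i | j)
      · fin_cases i <;> simp [hy0, hy1]
      · simp [hz]
    · rw [e1]
      simp only [Matrix.cons_val]
      refine ⟨?_, ?_, ?_, ?_, fun j => ?_⟩
      · linear_combination σ 0 * h0 - (Q 0 ⬝ᵥ z) * s0
      · linear_combination σ 1 * h1 - (Q 1 ⬝ᵥ z) * s1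
      · linear_combination - (Q 2 ⬝ᵥ z) * s2
      · linear_combination y 0 * s0 + y 1 * s1 - (y 0 + y 1) * s2
      · linear_combination h4 j

lemma star_count (σ : Fin 3 → K) (hσ : ∀ i, σ i * σ i = 1) (Q : Matrix (Fin 4) J K)
    (hQ : ∀ j, Q 3 j = 0) (R : Matrix J J K) (hR : Rᵀ = R) :
    (Fintype.card K) ^ 2 ∣ Nat.card {x : Fin 3 → K //
    (Matrix.fromBlocks !![x 0, 0, 0, σ 0; 0, x 1, 0, σ 1; 0, 0, x 2, σ 2; σ 0, σ 1, σ 2, 0]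
      Q Qᵀ R).det = 0} := by
  refine (core_count (Matrix.of ![fun j => σ 0 * Q 0 j - σ 2 * Q 2 j,
    fun j => σ 1 * Q 1 j - σ 2 * Q 2 j]) R hR).trans (dvd_of_eq (Nat.card_congr
      (Equiv.symm (Equiv.subtypeEquiv
          { toFun := fun x => (x 0 + x 2, (x 1 + x 2, x 2))
            invFun := fun p => ![p.1 - p.2.2, p.2.1 - p.2.2, p.2.2]
            left_inv := fun x => by ext i; fin_cases i <;> simp
            right_inv := fun p => by simp } (fun x => ?_)))))
  exact star_det x σ hσ Q hQ R

end Counting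
section Abstract

variable {K : Type} [Field K] [Fintype K]

lemma natcard_filter {α : Type} [Fintype α] (P : α → Prop) :
    Nat.card {x : α // P x} = (Finset.univ.filter P).card := by
  rw [Nat.card_eq_fintype_card, Fintype.card_subtype]

lemma abs_count {X Y : Type} [Fintype X] [Fintype Y] (ψ1 φ1 : X → K) (ψ2 φ2 : Y → K)
    (hX : (Fintype.card K) ^ 2 ∣ Fintype.card X) (hY : (Fintype.card K) ^ 2 ∣ Fintype.card Y)
    (h1 : ∀ s t : K, (s ≠ 0 ∨ t ≠ 0) →
      (Fintype.card K) ^ 2 ∣ Nat.card {x : X // s * ψ1 x + t * φ1 x = 0})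
    (h2 : ∀ s t : K, (s ≠ 0 ∨ t ≠ 0) →
      (Fintype.card K) ^ 2 ∣ Nat.card {y : Y // s * ψ2 y + t * φ2 y = 0}) :
    (Fintype.card K) ^ 3 ∣ Nat.card {p : X × Y // ψ1 p.1 * φ2 p.2 + φ1 p.1 * ψ2 p.2 = 0} := by
  set q := Fintype.card K with hq
  have hq0 : 0 < q := Fintype.card_pos
  set Z := (Finset.univ.filter fun y : Y => φ2 y = 0 ∧ ψ2 y = 0).card with hZ
  -- counts on fibres
  have hA : ∀ t : K, (Finset.univ.filter fun y : Y => φ2 y ≠ 0 ∧ ψ2 y / φ2 y = t).card + Z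
      = Nat.card {y : Y // 1 * ψ2 y + (-t) * φ2 y = 0} := by
    intro t
    rw [natcard_filter, hZ, ← Finset.card_union_of_disjoint]
    · congr 1
      ext y
      simp only [Finset.mem_union, Finset.mem_filter, Finset.mem_univ, true_and]
      by_cases h : φ2 y = 0
      · simp [h]
      · simp only [h, ne_eq, not_false_eq_true, true_and, false_and, or_false]
        rw [div_eq_iff h, one_mul, neg_mul, ← sub_eq_add_neg, sub_eq_zero]
    · rw [Finset.disjoint_filter]
      intro y _ h h'
      exact h.1 h'.1
  have hB : (Finset.univ.filter fun y : Y => φ2 y = 0 ∧ ψ2 y ≠ 0).card + Z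
      = Nat.card {y : Y // 0 * ψ2 y + 1 * φ2 y = 0} := by
    rw [natcard_filter, hZ, ← Finset.card_union_of_disjoint]
    · congr 1
      ext y
      simp only [Finset.mem_union, Finset.mem_filter, Finset.mem_univ, true_and]
      by_cases h : ψ2 y = 0 <;> simp [h]
    · rw [Finset.disjoint_filter]
      intro y _ h h'
      exact h.2 h'.2
  have hC : (Finset.univ.filter fun y : Y => φ2 y ≠ 0).card
      + Nat.card {y : Y // 0 * ψ2 y + 1 * φ2 y = 0} = Fintype.card Y := by
    rw [natcard_filter, add_comm, ← Finset.card_univ]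
    simp only [zero_mul, one_mul, zero_add]
    exact Finset.card_filter_add_card_filter_not _
  have hD : (Finset.univ.filter fun y : Y => φ2 y ≠ 0).card
      = ∑ t : K, (Finset.univ.filter fun y : Y => φ2 y ≠ 0 ∧ ψ2 y / φ2 y = t).card := by
    rw [Finset.card_eq_sum_card_fiberwise (f := fun y => ψ2 y / φ2 y) (t := Finset.univ)
      (by simp)]
    simp only [Finset.filter_filter]
  have hqZ : q ∣ Z := by
    have e1 : q ^ 2 ∣ ∑ t : K, Nat.card {y : Y // 1 * ψ2 y + (-t) * φ2 y = 0} :=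
      Finset.dvd_sum fun t _ => h2 1 (-t) (Or.inl one_ne_zero)
    have e2 : ∑ t : K, Nat.card {y : Y // 1 * ψ2 y + (-t) * φ2 y = 0}
        = (Finset.univ.filter fun y : Y => φ2 y ≠ 0).card + q * Z := by
      simp only [← hA]
      rw [Finset.sum_add_distrib, ← hD]
      simp [hq]
    have e3 : q ^ 2 ∣ (Finset.univ.filter fun y : Y => φ2 y ≠ 0).card := by
      have := h2 0 1 (Or.inr one_ne_zero)
      rw [← hC] at hY
      exact (Nat.dvd_add_left this).1 hY
    rw [e2] at e1
    have := (Nat.dvd_add_right e3).1 e1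
    rw [pow_two] at this
    exact Nat.dvd_of_mul_dvd_mul_left hq0 this
  have hqA : ∀ t : K, q ∣ (Finset.univ.filter fun y : Y => φ2 y ≠ 0 ∧ ψ2 y / φ2 y = t).card := by
    intro t
    have := (dvd_pow_self q two_ne_zero).trans (h2 1 (-t) (Or.inl one_ne_zero))
    rw [← hA] at this
    exact (Nat.dvd_add_left hqZ).1 this
  have hqB : q ∣ (Finset.univ.filter fun y : Y => φ2 y = 0 ∧ ψ2 y ≠ 0).card := by
    have := (dvd_pow_self q two_ne_zero).trans (h2 0 1 (Or.inr one_ne_zero))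
    rw [← hB] at this
    exact (Nat.dvd_add_left hqZ).1 this
  -- main count
  have hN : Nat.card {p : X × Y // ψ1 p.1 * φ2 p.2 + φ1 p.1 * ψ2 p.2 = 0}
      = ∑ y : Y, Nat.card {x : X // ψ1 x * φ2 y + φ1 x * ψ2 y = 0} := by
    rw [← natcard_prod_sum (fun p : Y × X => ψ1 p.2 * φ2 p.1 + φ1 p.2 * ψ2 p.1 = 0)]
    exact Nat.card_congr ((Equiv.prodComm X Y).subtypeEquiv fun p => Iff.rfl)
  rw [hN, ← Finset.sum_filter_add_sum_filter_not Finset.univ (fun y => φ2 y ≠ 0)]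
  apply dvd_add
  · rw [← Finset.sum_fiberwise (s := Finset.univ.filter fun y => φ2 y ≠ 0)
      (g := fun y => ψ2 y / φ2 y)]
    refine Finset.dvd_sum fun t _ => ?_
    rw [Finset.filter_filter]
    have : ∀ y ∈ Finset.univ.filter (fun y => φ2 y ≠ 0 ∧ ψ2 y / φ2 y = t),
        Nat.card {x : X // ψ1 x * φ2 y + φ1 x * ψ2 y = 0}
          = Nat.card {x : X // 1 * ψ1 x + t * φ1 x = 0} := by
      intro y hy
      obtain ⟨hy0, hy1⟩ := (Finset.mem_filter.1 hy).2
      apply Nat.card_congr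
      apply Equiv.subtypeEquivRight
      intro x
      have : ψ1 x * φ2 y + φ1 x * ψ2 y = φ2 y * (1 * ψ1 x + t * φ1 x) := by
        rw [← hy1]; field_simp
      rw [this, mul_eq_zero, or_iff_right hy0]
    rw [Finset.sum_congr rfl this, Finset.sum_const, smul_eq_mul, pow_succ']
    exact mul_dvd_mul (hqA t) (h1 1 t (Or.inl one_ne_zero))
  · rw [← Finset.sum_filter_add_sum_filter_not (Finset.univ.filter fun y => ¬ φ2 y ≠ 0)
      (fun y => ψ2 y ≠ 0), Finset.filter_filter, Finset.filter_filter]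
    apply dvd_add
    · have : ∀ y ∈ Finset.univ.filter (fun y => ¬ φ2 y ≠ 0 ∧ ψ2 y ≠ 0),
        Nat.card {x : X // ψ1 x * φ2 y + φ1 x * ψ2 y = 0}
          = Nat.card {x : X // 0 * ψ1 x + 1 * φ1 x = 0} := by
        intro y hy
        obtain ⟨hy0, hy1⟩ := (Finset.mem_filter.1 hy).2
        rw [not_not] at hy0
        apply Nat.card_congr
        apply Equiv.subtypeEquivRight
        intro x
        simp [hy0, hy1]
      rw [Finset.sum_congr rfl this, Finset.sum_const, smul_eq_mul, pow_succ']
      simp only [not_not]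
      exact mul_dvd_mul hqB (h1 0 1 (Or.inr one_ne_zero))
    · have : ∀ y ∈ Finset.univ.filter (fun y => ¬ φ2 y ≠ 0 ∧ ¬ ψ2 y ≠ 0),
        Nat.card {x : X // ψ1 x * φ2 y + φ1 x * ψ2 y = 0} = Fintype.card X := by
        intro y hy
        obtain ⟨hy0, hy1⟩ := (Finset.mem_filter.1 hy).2
        rw [not_not] at hy0 hy1
        simp [hy0, hy1]
      rw [Finset.sum_congr rfl this, Finset.sum_const, smul_eq_mul, pow_succ']
      simp only [not_not]
      exact mul_dvd_mul hqZ hX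

lemma family_star {E I : Type} [Fintype E] [Fintype I] (ι : E → I) (hι : Function.Injective ι)
    (N : Matrix I I K) (hN : Nᵀ = N) (f : Fin 3 → E) (hf : Function.Injective f) (p : I)
    (hp : ∀ e, ι e ≠ p) (σ : Fin 3 → K) (hσ : ∀ i, σ i * σ i = 1)
    (h1 : ∀ i, N p (ι (f i)) = σ i) (h0 : ∀ j, (∀ i, j ≠ ι (f i)) → N p j = 0)
    (h2 : ∀ i j, N (ι (f i)) (ι (f j)) = 0) :
    (Fintype.card K) ^ 2 ∣
      Nat.card {x : E → K // (N + Matrix.diagonal (Function.extend ι x 0)).det = 0} := by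
  let φ : Fin 4 → I := ![ι (f 0), ι (f 1), ι (f 2), p]
  have hφ : Function.Injective φ := by
    have a01 : f 0 ≠ f 1 := fun h => by simpa using hf h
    have a02 : f 0 ≠ f 2 := fun h => by simpa using hf h
    have a12 : f 1 ≠ f 2 := fun h => by simpa using hf h
    have b0 := hp (f 0)
    have b1 := hp (f 1)
    have b2 := hp (f 2)
    intro i j h
    fin_cases i <;> fin_cases j <;>
      simp [φ, hι.eq_iff, a01, a02, a12, a01.symm, a02.symm, a12.symm, b0, b1, b2, b0.symm,
        b1.symm, b2.symm] at h ⊢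
  let J := {i : I // i ∉ Set.range φ}
  let eI : Fin 4 ⊕ J ≃ I :=
    ((Equiv.ofInjective φ hφ).sumCongr (Equiv.refl _)).trans (Equiv.Set.sumCompl (Set.range φ))
  have eI1 : ∀ i, eI (Sum.inl i) = φ i := fun i => rfl
  have eI2 : ∀ j : J, eI (Sum.inr j) = j.1 := fun j => rfl
  let E' := {e : E // e ∉ Set.range f}
  let eE : Fin 3 ⊕ E' ≃ E :=
    ((Equiv.ofInjective f hf).sumCongr (Equiv.refl _)).trans (Equiv.Set.sumCompl (Set.range f))
  have eE1 : ∀ i, eE (Sum.inl i) = f i := fun i => rfl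
  have eE2 : ∀ j : E', eE (Sum.inr j) = j.1 := fun j => rfl
  let cmb : (E' → K) × (Fin 3 → K) ≃ (E → K) :=
    ((Equiv.prodComm _ _).trans (Equiv.sumArrowEquivProdArrow _ _ _).symm).trans
      (eE.arrowCongr (Equiv.refl K))
  have cmb1 : ∀ u y i, cmb (u, y) (f i) = y i := by
    intro u y i
    simp [cmb, ← eE1]
  have cmb2 : ∀ u y (e : E'), cmb (u, y) e.1 = u e := by
    intro u y i
    simp [cmb, ← eE2]
  rw [← Nat.card_congr (cmb.subtypeEquiv (p := fun z =>
    (N + Matrix.diagonal (Function.extend ι (cmb z) 0)).det = 0) fun z => Iff.rfl),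
    natcard_prod_sum]
  refine Finset.dvd_sum fun u _ => ?_
  let Q : Matrix (Fin 4) J K := Matrix.of fun i j => N (φ i) j.1
  let R : Matrix J J K := Matrix.of fun i j =>
    (N + Matrix.diagonal (Function.extend ι (cmb (u, 0)) 0)) i.1 j.1
  have hQ : ∀ j, Q 3 j = 0 := by
    rintro ⟨j, hj⟩
    apply h0
    intro i h
    apply hj
    fin_cases i
    · exact ⟨0, h.symm⟩
    · exact ⟨1, h.symm⟩
    · exact ⟨2, h.symm⟩
  have hNs : ∀ i j, N i j = N j i := fun i j => congrFun (congrFun hN.symm i) j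
  have hR : Rᵀ = R := by
    ext i j
    simp only [R, Matrix.transpose_apply, Matrix.of_apply, Matrix.add_apply]
    rw [hNs]
    congr 1
    rw [← Matrix.transpose_apply (Matrix.diagonal _), Matrix.diagonal_transpose]
  refine (star_count σ hσ Q hQ R hR).trans (dvd_of_eq (Nat.card_congr
    (Equiv.subtypeEquivRight fun y => ?_)))
  rw [← Matrix.det_submatrix_equiv_self eI]
  have hext : ∀ i, Function.extend ι (cmb (u, y)) 0 (ι (f i)) = y i := by
    intro i; rw [hι.extend_apply, cmb1]
  have hextp : Function.extend ι (cmb (u, y)) 0 p = 0 := by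
    rw [Function.extend_apply']; rfl
    rintro ⟨e, he⟩; exact hp e he
  have hextJ : ∀ j : J, Function.extend ι (cmb (u, y)) 0 j.1
      = Function.extend ι (cmb (u, 0)) 0 j.1 := by
    intro j
    by_cases hj : ∃ e, ι e = j.1
    · obtain ⟨e, he⟩ := hj
      rw [← he, hι.extend_apply, hι.extend_apply]
      have : e ∉ Set.range f := by
        rintro ⟨i, rfl⟩
        apply j.2
        rw [← he]
        fin_cases i
        · exact ⟨0, rfl⟩
        · exact ⟨1, rfl⟩
        · exact ⟨2, rfl⟩
      rw [cmb2 u y ⟨e, this⟩, cmb2 u 0 ⟨e, this⟩]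
    · rw [Function.extend_apply' _ _ _ hj, Function.extend_apply' _ _ _ hj]
  have hpp : N p p = 0 := h0 p fun i h => hp _ h.symm
  have key : (N + Matrix.diagonal (Function.extend ι (cmb (u, y)) 0)).submatrix eI eI
      = Matrix.fromBlocks
        !![y 0, 0, 0, σ 0; 0, y 1, 0, σ 1; 0, 0, y 2, σ 2; σ 0, σ 1, σ 2, 0] Q Qᵀ R := by
    ext (i | i) (j | j)
    · rw [Matrix.submatrix_apply, eI1, eI1, Matrix.fromBlocks_apply₁₁, Matrix.add_apply,
        Matrix.diagonal_apply, hφ.eq_iff]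
      fin_cases i <;> fin_cases j <;>
        simp [φ, h2, h1, hext, hextp, hpp, hNs _ p]
    · rw [Matrix.submatrix_apply, eI1, eI2, Matrix.fromBlocks_apply₁₂, Matrix.add_apply,
        Matrix.diagonal_apply_ne, add_zero]
      · rfl
      · intro h; exact j.2 ⟨i, h⟩
    · rw [Matrix.submatrix_apply, eI1, eI2, Matrix.fromBlocks_apply₂₁, Matrix.add_apply,
        Matrix.diagonal_apply_ne, add_zero, hNs]
      · rfl
      · intro h; exact i.2 ⟨j, h.symm⟩
    · rw [Matrix.submatrix_apply, eI2, eI2, Matrix.fromBlocks_apply₂₂]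
      simp only [R, Matrix.of_apply, Matrix.add_apply, Matrix.diagonal_apply, hextJ]
  rw [key]
  convert! Iff.rfl

end Abstract
section Cut

variable {K : Type} [Field K] {I : Type} [Fintype I]

/-- principal submatrix, padded with the identity -/
noncomputable def maskM (H : I → Prop) (M : Matrix I I K) : Matrix I I K :=
  Matrix.of fun i j => if H i ∧ H j then M i j else if i = j then 1 else 0

lemma mask_det (H : I → Prop) (M : Matrix I I K) :
    (maskM H M).det = (M.toSquareBlockProp H).det := by
  rw [Matrix.twoBlockTriangular_det _ H]
  · have h1 : (maskM H M).toSquareBlockProp H = M.toSquareBlockProp H := by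
      ext i j
      simp [Matrix.toSquareBlockProp, maskM, i.2, j.2]
    have h2 : (maskM H M).toSquareBlockProp (fun i => ¬ H i) = 1 := by
      ext i j
      simp [Matrix.toSquareBlockProp, maskM, i.2, j.2, Matrix.one_apply, Subtype.ext_iff]
    rw [h1, h2]
    simp
  · intro i hi j hj
    have : i ≠ j := by rintro rfl; exact hi hj
    simp [maskM, hi, this]

lemma mask_congr (H : I → Prop) (M M' : Matrix I I K)
    (h : ∀ i j, H i → H j → M i j = M' i j) : maskM H M = maskM H M' := by
  ext i j
  simp only [maskM, Matrix.of_apply]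
  split_ifs with h1
  · exact h i j h1.1 h1.2
  · rfl
  · rfl

lemma det_tri (H : I → Prop) (M : Matrix I I K) (h : ∀ i, ¬ H i → ∀ j, H j → M i j = 0) :
    M.det = (maskM H M).det * (maskM (fun i => ¬ H i) M).det := by
  rw [mask_det, mask_det, Matrix.twoBlockTriangular_det M H h]
  congr!

lemma det_tri' (H : I → Prop) (M : Matrix I I K) (h : ∀ i, H i → ∀ j, ¬ H j → M i j = 0) :
    M.det = (maskM H M).det * (maskM (fun i => ¬ H i) M).det := by
  rw [mask_det, mask_det, Matrix.twoBlockTriangular_det' M H h]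
  congr!

lemma two_cut (M : Matrix I I K) (P : I → Prop) (b : I) (hb : ¬ P b) (hbb : M b b = 0)
    (h1 : ∀ i j, P i → ¬ P j → j ≠ b → M i j = 0)
    (h2 : ∀ i j, ¬ P i → i ≠ b → P j → M i j = 0) :
    M.det = (maskM (fun i => P i ∨ i = b) M).det * (maskM (fun i => ¬ P i ∧ i ≠ b) M).det
      + (maskM P M).det * (maskM (fun i => ¬ P i) M).det := by
  let r1 : I → K := fun j => if P j then M b j else 0
  let r2 : I → K := fun j => if P j then 0 else M b j
  have hr : M = M.updateRow b (r1 + r2) := by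
    conv_lhs => rw [← Matrix.updateRow_eq_self M b]
    congr 1
    ext j
    by_cases hj : P j <;> simp [r1, r2, hj]
  conv_lhs => rw [hr, Matrix.det_updateRow_add]
  congr 1
  · rw [det_tri' (fun i => P i ∨ i = b)]
    · congr 2
      · apply mask_congr
        intro i j hi hj
        by_cases hib : i = b
        · subst hib
          rw [Matrix.updateRow_self]
          rcases hj with hj | rfl
          · simp [r1, hj]
          · simp [r1, hb, hbb]
        · rw [Matrix.updateRow_ne hib]
      · have : (fun i => ¬ (P i ∨ i = b)) = (fun i => ¬ P i ∧ i ≠ b) := by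
          ext i; rw [not_or]
        rw [this]
        apply mask_congr
        intro i j hi hj
        rw [Matrix.updateRow_ne hi.2]
    · intro i hi j hj
      rw [not_or] at hj
      by_cases hib : i = b
      · subst hib
        rw [Matrix.updateRow_self]
        simp [r1, hj]
      · rw [Matrix.updateRow_ne hib]
        exact h1 i j (hi.resolve_right hib) hj.1 hj.2
  · rw [det_tri P]
    · congr 2
      · apply mask_congr
        intro i j hi hj
        rw [Matrix.updateRow_ne (by rintro rfl; exact hb hi)]
      · apply mask_congr
        intro i j hi hj
        by_cases hib : i = b
        · subst hib
          rw [Matrix.updateRow_self]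
          simp [r2, hj]
        · rw [Matrix.updateRow_ne hib]
    · intro i hi j hj
      by_cases hib : i = b
      · subst hib
        rw [Matrix.updateRow_self]
        simp [r2, hj]
      · rw [Matrix.updateRow_ne hib]
        exact h2 i j hi hib hj

lemma det_add_single (H : I → Prop) (M : Matrix I I K) (b : I) (hb : H b) (t : K) :
    (maskM H M + Matrix.single b b t).det
      = (maskM H M).det + t * (maskM (fun i => H i ∧ i ≠ b) M).det := by
  have h1 : maskM H M + Matrix.single b b t
      = (maskM H M).updateRow b (maskM H M b + t • Pi.single b 1) := by
    ext i j
    by_cases hib : i = b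
    · subst hib
      rw [Matrix.updateRow_self]
      by_cases hj : j = i
      · subst hj; simp
      · simp [hj, Matrix.single_apply_of_col_ne, Ne.symm hj]
    · rw [Matrix.updateRow_ne hib]
      simp [Matrix.single_apply, Ne.symm hib]
  rw [h1, Matrix.det_updateRow_add, Matrix.det_updateRow_smul, Matrix.updateRow_eq_self]
  congr 2
  rw [det_tri (fun i => H i ∧ i ≠ b)]
  · have e1 : maskM (fun i => ¬ (H i ∧ i ≠ b))
        ((maskM H M).updateRow b (Pi.single b 1)) = 1 := by
      ext i j
      simp only [maskM, Matrix.of_apply, Matrix.one_apply]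
      split_ifs with h h' h'
      · subst h'
        by_cases hib : i = b
        · subst hib; simp
        · have : ¬ H i := fun hh => h.1 ⟨hh, hib⟩
          simp [Matrix.updateRow_ne hib, this]
      · by_cases hib : i = b
        · subst hib
          simp [Pi.single_apply, Ne.symm h']
        · have : ¬ H i := fun hh => h.1 ⟨hh, hib⟩
          simp [Matrix.updateRow_ne hib, this, h']
      · rfl
      · rfl
    rw [e1, Matrix.det_one, mul_one]
    congr 1
    apply mask_congr
    intro i j hi hj
    rw [Matrix.updateRow_ne hi.2]
    simp [maskM, hi.1, hj.1]
  · intro i hi j hj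
    by_cases hib : i = b
    · subst hib
      simp [Pi.single_apply, hj.2]
    · have h3 : ¬ H i := fun hh => hi ⟨hh, hib⟩
      have h4 : i ≠ j := by rintro rfl; exact h3 hj.1
      simp [Matrix.updateRow_ne hib, maskM, h3, h4]

lemma mask_add_diag {E : Type} (ι : E → I) (N : Matrix I I K) (H : I → Prop)
    (hι : ∀ e, H (ι e)) (x : E → K) :
    maskM H (N + Matrix.diagonal (Function.extend ι x 0))
      = maskM H N + Matrix.diagonal (Function.extend ι x 0) := by
  ext i j
  simp only [maskM, Matrix.of_apply, Matrix.add_apply, Matrix.diagonal_apply]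
  by_cases hij : i = j
  · subst hij
    by_cases hi : H i
    · simp [hi]
    · have : Function.extend ι x 0 i = 0 := by
        rw [Function.extend_apply']; rfl
        rintro ⟨e, rfl⟩; exact hi (hι e)
      simp [hi, this]
  · simp [hij]

variable [Fintype K]

lemma side_count {E : Type} [Fintype E] (ι : E → I) (hι : Function.Injective ι)
    (N : Matrix I I K) (hN : Nᵀ = N) (H : I → Prop) (b : I) (hb : H b) (hH : ∀ e, H (ι e))
    (hιb : ∀ e, ι e ≠ b)
    (f : Fin 3 → E) (hf : Function.Injective f) (p : I) (hpH : H p) (hpb : p ≠ b)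
    (hp : ∀ e, ι e ≠ p) (σ : Fin 3 → K) (hσ : ∀ i, σ i * σ i = 1)
    (h1 : ∀ i, N p (ι (f i)) = σ i) (h0 : ∀ j, H j → (∀ i, j ≠ ι (f i)) → N p j = 0)
    (h2 : ∀ i j, N (ι (f i)) (ι (f j)) = 0) (s t : K) (hst : s ≠ 0 ∨ t ≠ 0) :
    (Fintype.card K) ^ 2 ∣
      Nat.card {x : E → K // s * (maskM H (N + Matrix.diagonal (Function.extend ι x 0))).det
        + t * (maskM (fun i => H i ∧ i ≠ b)
          (N + Matrix.diagonal (Function.extend ι x 0))).det = 0} := by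
  have hNs : ∀ i j, N i j = N j i := fun i j => congrFun (congrFun hN.symm i) j
  have hsym : ∀ H : I → Prop, (maskM H N)ᵀ = maskM H N := by
    intro H
    ext i j
    simp only [maskM, Matrix.transpose_apply, Matrix.of_apply, hNs j i, and_comm, eq_comm]
  by_cases hs : s = 0
  · have ht : t ≠ 0 := hst.resolve_left (not_not.2 hs)
    refine (family_star ι hι (maskM (fun i => H i ∧ i ≠ b) N) (hsym _) f hf p hp σ hσ
      ?_ ?_ ?_).trans (dvd_of_eq (Nat.card_congr (Equiv.subtypeEquivRight fun x => ?_)))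
    · intro i; simp [maskM, hpH, hpb, hH, hιb, h1]
    · intro j hj
      by_cases hjH : H j ∧ j ≠ b
      · simp [maskM, hpH, hpb, hjH.1, hjH.2, h0 j hjH.1 hj]
      · have : p ≠ j := by rintro rfl; exact hjH ⟨hpH, hpb⟩
        simp [maskM, hjH, this]
    · intro i j; simp [maskM, hH, hιb, h2]
    · rw [mask_add_diag ι N (fun i => H i ∧ i ≠ b) (fun e => ⟨hH e, hιb e⟩)]
      simp [hs, ht]
  · refine (family_star ι hι (maskM H N + Matrix.single b b (t / s)) ?_ f hf p hp σ hσ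
      ?_ ?_ ?_).trans (dvd_of_eq (Nat.card_congr (Equiv.subtypeEquivRight fun x => ?_)))
    · rw [Matrix.transpose_add, hsym, Matrix.transpose_single]
    · intro i
      simp [maskM, hpH, hH, h1, Matrix.single_apply, Ne.symm hpb]
    · intro j hj
      have e1 : maskM H N p j = 0 := by
        by_cases hjH : H j
        · simp [maskM, hpH, hjH, h0 j hjH hj]
        · have : p ≠ j := by rintro rfl; exact hjH hpH
          simp [maskM, hjH, this]
      simp [e1, Matrix.single_apply, Ne.symm hpb]
    · intro i j
      simp [maskM, hH, h2, Matrix.single_apply, Ne.symm (hιb (f i))]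
    · have e2 : maskM H N + Matrix.single b b (t / s)
          + Matrix.diagonal (Function.extend ι x 0)
          = maskM H (N + Matrix.diagonal (Function.extend ι x 0))
            + Matrix.single b b (t / s) := by
        rw [mask_add_diag ι N H hH]; abel
      rw [e2, det_add_single H _ b hb]
      have e3 : ∀ A B : K, s * A + t * B = s * (A + t / s * B) := by
        intro A B; field_simp
      rw [e3, mul_eq_zero, or_iff_right hs]

lemma cut_count {E : Type} [Fintype E] (ι : E → I) (hι : Function.Injective ι)
    (N : Matrix I I K) (hN : Nᵀ = N) (P : I → Prop) (b : I) (hb : ¬ P b) (hιb : ∀ e, ι e ≠ b)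
    (hbb : N b b = 0) (hP : ∀ i j, P i → ¬ P j → j ≠ b → N i j = 0)
    (f : Fin 3 → E) (hf : Function.Injective f) (p : I) (hfP : ∀ i, P (ι (f i))) (hpP : P p)
    (hp : ∀ e, ι e ≠ p) (σ : Fin 3 → K) (hσ : ∀ i, σ i * σ i = 1)
    (h1 : ∀ i, N p (ι (f i)) = σ i) (h0 : ∀ j, (∀ i, j ≠ ι (f i)) → N p j = 0)
    (h2 : ∀ i j, N (ι (f i)) (ι (f j)) = 0)
    (f' : Fin 3 → E) (hf' : Function.Injective f') (p' : I) (hfP' : ∀ i, ¬ P (ι (f' i)))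
    (hpP' : ¬ P p') (hpb' : p' ≠ b)
    (hp' : ∀ e, ι e ≠ p') (σ' : Fin 3 → K) (hσ' : ∀ i, σ' i * σ' i = 1)
    (h1' : ∀ i, N p' (ι (f' i)) = σ' i) (h0' : ∀ j, (∀ i, j ≠ ι (f' i)) → N p' j = 0)
    (h2' : ∀ i j, N (ι (f' i)) (ι (f' j)) = 0) :
    (Fintype.card K) ^ 3 ∣
      Nat.card {x : E → K // (N + Matrix.diagonal (Function.extend ι x 0)).det = 0} := by
  have hNs : ∀ i j, N i j = N j i := fun i j => congrFun (congrFun hN.symm i) j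
  let E1 := {e : E // P (ι e)}
  let E2 := {e : E // ¬ P (ι e)}
  let ι1 : E1 → I := fun e => ι e.1
  let ι2 : E2 → I := fun e => ι e.1
  have hι1 : Function.Injective ι1 := hι.comp Subtype.val_injective
  have hι2 : Function.Injective ι2 := hι.comp Subtype.val_injective
  let sp : (E → K) ≃ (E1 → K) × (E2 → K) :=
    Equiv.piEquivPiSubtypeProd (fun e => P (ι e)) (fun _ => K)
  let M1 : (E1 → K) → Matrix I I K := fun x => N + Matrix.diagonal (Function.extend ι1 x 0)
  let M2 : (E2 → K) → Matrix I I K := fun x => N + Matrix.diagonal (Function.extend ι2 x 0)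
  have hb1 : ∀ x : E → K, Function.extend ι x 0 b = 0 := by
    intro x
    rw [Function.extend_apply']; rfl
    rintro ⟨e, he⟩; exact hιb e he
  have hx1 : ∀ x : E → K, ∀ i, (P i ∨ i = b) →
      Function.extend ι x 0 i = Function.extend ι1 (sp x).1 0 i := by
    intro x i hi
    by_cases h : ∃ e, ι e = i
    · obtain ⟨e, rfl⟩ := h
      have he : P (ι e) := hi.resolve_right (hιb e)
      rw [hι.extend_apply, show ι e = ι1 ⟨e, he⟩ from rfl, hι1.extend_apply]
      rfl
    · rw [Function.extend_apply' _ _ _ h, Function.extend_apply']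
      rintro ⟨e, he⟩; exact h ⟨e.1, he⟩
  have hx2 : ∀ x : E → K, ∀ i, ¬ P i →
      Function.extend ι x 0 i = Function.extend ι2 (sp x).2 0 i := by
    intro x i hi
    by_cases h : ∃ e, ι e = i
    · obtain ⟨e, rfl⟩ := h
      rw [hι.extend_apply, show ι e = ι2 ⟨e, hi⟩ from rfl, hι2.extend_apply]
      rfl
    · rw [Function.extend_apply' _ _ _ h, Function.extend_apply']
      rintro ⟨e, he⟩; exact h ⟨e.1, he⟩
  have hc : ∀ (H : I → Prop) (u v : I → K), (∀ i, H i → u i = v i) →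
      maskM H (N + Matrix.diagonal u) = maskM H (N + Matrix.diagonal v) := by
    intro H u v huv
    apply mask_congr
    intro i j hi hj
    simp only [Matrix.add_apply, Matrix.diagonal_apply, huv i hi]
  have hcard : ∀ (E' : Type) [Fintype E'] [DecidableEq E'] (g : Fin 3 → E'), Function.Injective g →
      (Fintype.card K) ^ 2 ∣ Fintype.card (E' → K) := by
    intro E' _ _ g hg
    rw [Fintype.card_fun]
    apply pow_dvd_pow
    have := Fintype.card_le_of_injective g hg
    simp at this
    omega
  have g1inj : Function.Injective (fun i => (⟨f i, hfP i⟩ : E1)) := fun i j h =>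
    hf (congrArg Subtype.val h)
  have g2inj : Function.Injective (fun i => (⟨f' i, hfP' i⟩ : E2)) := fun i j h =>
    hf' (congrArg Subtype.val h)
  have hp1b : p ≠ b := by rintro rfl; exact hb hpP
  have key := abs_count (K := K)
    (fun x => (maskM (fun i => P i ∨ i = b) (M1 x)).det)
    (fun x => (maskM (fun i => (P i ∨ i = b) ∧ i ≠ b) (M1 x)).det)
    (fun y => (maskM (fun i => ¬ P i) (M2 y)).det)
    (fun y => (maskM (fun i => ¬ P i ∧ i ≠ b) (M2 y)).det)
    (hcard E1 _ g1inj) (hcard E2 _ g2inj)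
    (fun s t hst => side_count ι1 hι1 N hN (fun i => P i ∨ i = b) b (Or.inr rfl)
      (fun e => Or.inl e.2) (fun e => hιb e.1) _ g1inj p (Or.inl hpP) hp1b (fun e => hp e.1)
      σ hσ h1 (fun j _ hj => h0 j hj) h2 s t hst)
    (fun s t hst => side_count ι2 hι2 N hN (fun i => ¬ P i) b hb
      (fun e => e.2) (fun e => hιb e.1) _ g2inj p' hpP' hpb' (fun e => hp' e.1)
      σ' hσ' h1' (fun j _ hj => h0' j hj) h2' s t hst)
  refine key.trans (dvd_of_eq (Nat.card_congr (Equiv.symm (sp.subtypeEquiv fun x => ?_))))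
  have hor : (fun i => (P i ∨ i = b) ∧ i ≠ b) = P := by
    ext i
    constructor
    · rintro ⟨h | h, h'⟩
      · exact h
      · exact absurd h h'
    · intro h
      exact ⟨Or.inl h, by rintro rfl; exact hb h⟩
  rw [two_cut (N + Matrix.diagonal (Function.extend ι x 0)) P b hb]
  · simp only [hor, M1, M2]
    rw [hc (fun i => P i ∨ i = b) _ _ (hx1 x), hc P _ _ (fun i hi => hx1 x i (Or.inl hi)),
      hc (fun i => ¬ P i) _ _ (hx2 x), hc (fun i => ¬ P i ∧ i ≠ b) _ _ (fun i hi => hx2 x i hi.1)]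
  · simp [hbb, hb1]
  · intro i j hi hj hjb
    have : i ≠ j := by rintro rfl; exact hj hi
    simp [hP i j hi hj hjb, this]
  · intro i j hi hib hj
    have : i ≠ j := by rintro rfl; exact hi hj
    simp [hNs i j, hP j i hj hi hib, this]

end Cut
section Net

variable {V E : Type} [Fintype V] [Fintype E] {K : Type} [Field K] [Fintype K]

lemma net_count (s t : E → V) (hst : ∀ e, s e ≠ t e) (a b : V) (hab : a ≠ b) (S : V → Prop)
    (ha : ¬ S a) (hb : ¬ S b)
    (hs : ∀ e, S (s e) → S (t e) ∨ t e = a ∨ t e = b)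
    (ht : ∀ e, S (t e) → S (s e) ∨ s e = a ∨ s e = b)
    (p : V) (hp : S p) (f : Fin 3 → E) (hf : Function.Injective f)
    (hfp : ∀ e, (s e = p ∨ t e = p) ↔ ∃ i, e = f i)
    (p' : V) (hp' : ¬ S p') (hpa' : p' ≠ a) (hpb' : p' ≠ b)
    (f' : Fin 3 → E) (hf' : Function.Injective f')
    (hfp' : ∀ e, (s e = p' ∨ t e = p') ↔ ∃ i, e = f' i) :
    (Fintype.card K) ^ 3 ∣ Nat.card {x : E → K // netSing K s t a x} := by
  have hpa : p ≠ a := by rintro rfl; exact ha hp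
  let N : Matrix (E ⊕ V) (E ⊕ V) K := symM K s t a 0
  have hsym : ∀ x, symM K s t a x
      = N + Matrix.diagonal (Function.extend (Sum.inl : E → E ⊕ V) x 0) := by
    intro x
    ext (e | v) (e' | v')
    · rw [Matrix.add_apply, Matrix.diagonal_apply, Sum.inl_injective.extend_apply]
      simp [N, symM, Matrix.diagonal_apply]
    · simp [N, symM]
    · simp [N, symM]
    · rw [Matrix.add_apply, Matrix.diagonal_apply, Function.extend_apply' _ _ _ (by simp)]
      simp [N, symM, Matrix.diagonal_apply]
  have hinc : ∀ (w : V), w ≠ a → ∀ e, (s e = w ∨ t e = w) →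
      incM K s t a e w * incM K s t a e w = 1 := by
    rintro w hw e (rfl | rfl)
    · simp [incM, hw, hst e]
    · simp [incM, hw, (hst e).symm]
  have hinc0 : ∀ (w : V) e, ¬ (s e = w ∨ t e = w) → incM K s t a e w = 0 := by
    intro w e h
    rw [not_or] at h
    simp [incM, Ne.symm h.1, Ne.symm h.2]
  have hN0 : ∀ (w : V), w ≠ a → ∀ g : Fin 3 → E, (∀ e, (s e = w ∨ t e = w) ↔ ∃ i, e = g i) →
      ∀ j, (∀ i, j ≠ Sum.inl (g i)) → N (Sum.inr w) j = 0 := by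
    intro w hw g hg j hj
    rcases j with e | v
    · change incM K s t a e w = 0
      apply hinc0
      rw [hg]
      rintro ⟨i, rfl⟩
      exact hj i rfl
    · simp [N, symM, Matrix.diagonal_apply, hw]
  have hNN : ∀ e e', N (Sum.inl e) (Sum.inl e') = 0 := by
    intro e e'
    simp [N, symM, Matrix.diagonal_apply]
  have main := cut_count (K := K) (Sum.inl : E → E ⊕ V) Sum.inl_injective N
    (by simp [N, symM, Matrix.fromBlocks_transpose])
    (Sum.elim (fun e => S (s e) ∨ S (t e)) S) (Sum.inr b) hb (by simp)
    (by simp [N, symM, hab.symm])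
    (by
      rintro (e | v) (e' | v') h1 h2 h3
      · exact hNN _ _
      · change S (s e) ∨ S (t e) at h1
        change ¬ S v' at h2
        have h3 : v' ≠ b := fun h => h3 (by rw [h])
        change incM K s t a e v' = 0
        by_cases hv : v' = a
        · simp [incM, hv]
        apply hinc0
        rintro (rfl | rfl)
        · rcases ht e (h1.resolve_left h2) with h | h | h
          · exact h2 h
          · exact hv h
          · exact h3 h
        · rcases hs e (h1.resolve_right h2) with h | h | h
          · exact h2 h
          · exact hv h
          · exact h3 h
      · change S v at h1
        change ¬ (S (s e') ∨ S (t e')) at h2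
        change incM K s t a e' v = 0
        apply hinc0
        rintro (rfl | rfl)
        · exact h2 (Or.inl h1)
        · exact h2 (Or.inr h1)
      · change S v at h1
        change ¬ S v' at h2
        have : v ≠ v' := by rintro rfl; exact h2 h1
        simp [N, symM, Matrix.diagonal_apply, this])
    f hf (Sum.inr p)
    (by
      intro i
      change S _ ∨ S _
      rcases (hfp (f i)).2 ⟨i, rfl⟩ with h | h
      · left; rw [h]; exact hp
      · right; rw [h]; exact hp)
    hp (by simp) (fun i => incM K s t a (f i) p)
    (fun i => hinc p hpa _ ((hfp (f i)).2 ⟨i, rfl⟩)) (fun i => rfl) (hN0 p hpa f hfp)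
    (fun i j => hNN _ _)
    f' hf' (Sum.inr p')
    (by
      intro i
      change ¬ (S _ ∨ S _)
      rcases (hfp' (f' i)).2 ⟨i, rfl⟩ with h | h
      · rintro (h' | h')
        · rw [h] at h'; exact hp' h'
        · rcases ht _ h' with h1 | h1 | h1 <;> rw [h] at h1
          · exact hp' h1
          · exact hpa' h1
          · exact hpb' h1
      · rintro (h' | h')
        · rcases hs _ h' with h1 | h1 | h1 <;> rw [h] at h1
          · exact hp' h1
          · exact hpa' h1
          · exact hpb' h1
        · rw [h] at h'; exact hp' h')
    hp' (by simpa using hpb') (by simp) (fun i => incM K s t a (f' i) p')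
    (fun i => hinc p' hpa' _ ((hfp' (f' i)).2 ⟨i, rfl⟩)) (fun i => rfl) (hN0 p' hpa' f' hfp')
    (fun i j => hNN _ _)
  refine main.trans (dvd_of_eq (Nat.card_congr (Equiv.subtypeEquivRight fun x => ?_)))
  rw [netSing, hsym]
  convert! Iff.rfl

end Net

lemma graph_count {V : Type} [Fintype V] (G : SimpleGraph V) (K : Type) [Field K] [Fintype K]
    (a b : V) (hab : a ≠ b) (S : V → Prop) (ha : ¬ S a) (hb : ¬ S b)
    (hcut : ∀ u v, G.Adj u v → S u → S v ∨ v = a ∨ v = b)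
    (p : V) (hp : S p) (f : Fin 3 → V) (hf : Function.Injective f)
    (hfp : ∀ v, G.Adj p v ↔ ∃ i, v = f i)
    (p' : V) (hp' : ¬ S p') (hpa' : p' ≠ a) (hpb' : p' ≠ b)
    (f' : Fin 3 → V) (hf' : Function.Injective f')
    (hfp' : ∀ v, G.Adj p' v ↔ ∃ i, v = f' i) :
    (Fintype.card K) ^ 3 ∣ Xcount G K := by
  letI : Fintype G.edgeSet := Fintype.ofFinite _
  let s : G.edgeSet → V := fun e => (Quot.out (e : Sym2 V)).1
  let t : G.edgeSet → V := fun e => (Quot.out (e : Sym2 V)).2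
  have hst : ∀ e, s(s e, t e) = (e : Sym2 V) := fun e => Quot.out_eq (e : Sym2 V)
  have hadj : ∀ e, G.Adj (s e) (t e) := by
    intro e
    have := e.2
    rwa [← hst e, SimpleGraph.mem_edgeSet] at this
  have star : ∀ (w : V) (g : Fin 3 → V), Function.Injective g →
      (∀ v, G.Adj w v ↔ ∃ i, v = g i) → ∃ h : Fin 3 → G.edgeSet, Function.Injective h ∧
        ∀ e, (s e = w ∨ t e = w) ↔ ∃ i, e = h i := by
    intro w g hg hgw
    have hw : ∀ i, G.Adj w (g i) := fun i => (hgw _).2 ⟨i, rfl⟩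
    refine ⟨fun i => ⟨s(w, g i), hw i⟩, ?_, ?_⟩
    · intro i j hij
      have : s(w, g i) = s(w, g j) := congrArg Subtype.val hij
      rw [Sym2.congr_right] at this
      exact hg this
    · intro e
      constructor
      · rintro (h | h)
        · have h1 := hadj e
          rw [h, hgw] at h1
          obtain ⟨i, hi⟩ := h1
          refine ⟨i, Subtype.ext ?_⟩
          change (e : Sym2 V) = s(w, g i)
          rw [← hst e, h, hi]
        · have h1 := (hadj e).symm
          rw [h, hgw] at h1
          obtain ⟨i, hi⟩ := h1
          refine ⟨i, Subtype.ext ?_⟩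
          change (e : Sym2 V) = s(w, g i)
          rw [← hst e, h, hi, Sym2.eq_swap]
      · rintro ⟨i, rfl⟩
        have h1 := hst ⟨s(w, g i), hw i⟩
        simp only [Sym2.eq_iff] at h1
        rcases h1 with h1 | h1
        · left; exact h1.1
        · right; exact h1.2
  obtain ⟨h, hh, hhp⟩ := star p f hf hfp
  obtain ⟨h', hh', hhp'⟩ := star p' f' hf' hfp'
  have := net_count (K := K) s t (fun e => (hadj e).ne) a b hab S ha hb
    (fun e => hcut _ _ (hadj e)) (fun e => hcut _ _ (hadj e).symm) p hp h hh hhp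
    p' hp' hpa' hpb' h' hh' hhp'
  refine this.trans (dvd_of_eq (Nat.card_congr (Equiv.subtypeEquivRight fun x => ?_)))
  rw [graphPoly_zero_iff G K s t hst a x]
section Combinatorics

variable {W : Type} [Fintype W]

lemma closed_of_connected (Γ : SimpleGraph W) (hc : Γ.Connected) (S : W → Prop)
    (hS : ∀ u w, Γ.Adj u w → S u → S w) (x y : W) (hx : S x) : S y := by
  obtain ⟨p⟩ := hc.preconnected x y
  induction p with
  | nil => exact hx
  | cons h p ih => exact ih (hS _ _ h hx)

lemma nbr_image_card (Γ : SimpleGraph W) (h4 : ∀ w : W, Nat.card (Γ.neighborSet w) = 4) (w : W) :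
    ((Finset.univ.filter fun u => Γ.Adj w u)).card = 4 := by
  rw [← natcard_filter]
  exact h4 w

lemma one_exit (Γ : SimpleGraph W) (hΓ : IsCompletedPrimitive Γ) (S : W → Prop) (v : W)
    (hv : ¬ S v) (hS : ∀ u w, Γ.Adj u w → S u → S w ∨ w = v) (x : W) (hx : S x) (z : W)
    (hz : ¬ S z) (hzv : z ≠ v) : False := by
  obtain ⟨hc, h4, -, hC⟩ := hΓ
  have hinj : ∀ w : W, Function.Injective fun u => s(w, u) := fun w u u' h =>
    Sym2.congr_right.1 h
  set A := Finset.univ.filter fun u => Γ.Adj v u ∧ S u with hA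
  have hA1 : ∃ s, Γ.Adj v s ∧ S s := by
    by_contra hne
    push Not at hne
    refine hz (closed_of_connected Γ hc S (fun u w h hu => ?_) x z hx)
    rcases hS u w h hu with h1 | rfl
    · exact h1
    · exact absurd hu (hne u h.symm)
  have hA2 : ∃ w, Γ.Adj v w ∧ ¬ S w := by
    by_contra hne
    push Not at hne
    have := closed_of_connected Γ hc (fun u => S u ∨ u = v) (fun u w h hu => ?_) x z (Or.inl hx)
    · exact this.elim hz hzv
    · rcases hu with hu | rfl
      · exact hS u w h hu
      · exact Or.inl (hne w h)
  have hA3 : A.card < 4 := by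
    rw [← nbr_image_card Γ h4 v]
    apply Finset.card_lt_card
    rw [Finset.ssubset_iff_of_subset]
    · obtain ⟨w, hw, hwS⟩ := hA2
      exact ⟨w, by simp [hw], by simp [hA, hwS]⟩
    · intro u hu
      simp only [hA, Finset.mem_filter, Finset.mem_univ, true_and] at hu ⊢
      exact hu.1
  obtain ⟨s, hs, hsS⟩ := hA1
  obtain ⟨z', hz', hzv'⟩ : ∃ z', Γ.Adj z z' ∧ z' ≠ v := by
    have h1 : 1 < (Finset.univ.filter fun u => Γ.Adj z u).card := by
      rw [nbr_image_card Γ h4 z]; norm_num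
    obtain ⟨z', h2, h3⟩ := Finset.exists_mem_ne h1 v
    exact ⟨z', by simpa using h2, h3⟩
  have hzS' : ¬ S z' := by
    intro h
    rcases hS z' z hz'.symm h with h1 | h1
    · exact hz h1
    · exact hzv h1
  let C0 := insert s(z, z') (A.image fun u => s(v, u))
  let ES : Finset (Sym2 W) := Finset.univ.filter fun e => e ∈ Γ.edgeSet
  have hC0 : C0.card ≤ 4 := by
    refine (Finset.card_insert_le _ _).trans ?_
    have := Finset.card_image_le (s := A) (f := fun u => s(v, u))
    omega
  have hsub : C0 ⊆ ES := by
    intro e he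
    simp only [ES, Finset.mem_filter, Finset.mem_univ, true_and]
    rcases Finset.mem_insert.1 he with rfl | he
    · exact hz'
    · obtain ⟨u, hu, rfl⟩ := Finset.mem_image.1 he
      exact (Finset.mem_filter.1 hu).2.1
  have hES : 4 ≤ ES.card := by
    rw [← nbr_image_card Γ h4 v, ← Finset.card_image_of_injective _ (hinj v)]
    apply Finset.card_le_card
    intro e he
    obtain ⟨u, hu, rfl⟩ := Finset.mem_image.1 he
    simp only [ES, Finset.mem_filter, Finset.mem_univ, true_and] at hu ⊢
    exact hu
  obtain ⟨C, hC1, hC2, hC3⟩ := Finset.exists_subsuperset_card_eq hsub hC0 hES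
  rcases hC (C : Set (Sym2 W)) (fun e he => by simpa [ES] using hC2 he)
    (by simpa using hC3) with h | ⟨w, hw⟩
  · refine hz (closed_of_connected _ h S (fun u w h hu => ?_) x z hx)
    rw [SimpleGraph.deleteEdges_adj] at h
    rcases hS u w h.1 hu with h1 | rfl
    · exact h1
    · exfalso
      apply h.2
      apply hC1
      apply Finset.mem_insert_of_mem
      rw [Finset.mem_image]
      exact ⟨u, by simp [hA, h.1.symm, hu], Sym2.eq_swap⟩
  · have hI : (Finset.univ.filter fun u => Γ.Adj w u).image (fun u => s(w, u)) = C := by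
      apply Finset.eq_of_subset_of_card_le
      · intro e he
        obtain ⟨u, hu, rfl⟩ := Finset.mem_image.1 he
        have h1 := hw u
        rw [SimpleGraph.deleteEdges_adj] at h1
        by_contra h2
        exact h1 ⟨(Finset.mem_filter.1 hu).2, h2⟩
      · rw [Finset.card_image_of_injective _ (hinj w), nbr_image_card Γ h4 w, hC3]
    have e1 : s(z, z') ∈ C := hC1 (Finset.mem_insert_self _ _)
    have e2 : s(v, s) ∈ C := by
      apply hC1
      apply Finset.mem_insert_of_mem
      rw [Finset.mem_image]
      exact ⟨s, by simp [hA, hs, hsS], rfl⟩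
    rw [← hI] at e1 e2
    obtain ⟨u, -, hu⟩ := Finset.mem_image.1 e1
    obtain ⟨u', -, hu'⟩ := Finset.mem_image.1 e2
    have f1 : w = z ∨ w = z' := by
      have : w ∈ s(z, z') := by rw [← hu]; exact Sym2.mem_mk_left _ _
      simpa using this
    have f2 : w = v ∨ w = s := by
      have : w ∈ s(v, s) := by rw [← hu']; exact Sym2.mem_mk_left _ _
      simpa using this
    rcases f1 with rfl | rfl <;> rcases f2 with rfl | rfl
    · exact hzv rfl
    · exact hz hsS
    · exact hzv' rfl
    · exact hzS' hsS

lemma three_nbrs (Γ : SimpleGraph W) (h4 : ∀ w : W, Nat.card (Γ.neighborSet w) = 4)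
    (v p : W) (hpv : p ≠ v) (hadj : Γ.Adj p v) :
    ∃ f : Fin 3 → ↥{u : W | u ≠ v}, Function.Injective f ∧
      ∀ u, (delVert Γ v).Adj ⟨p, hpv⟩ u ↔ ∃ i, u = f i := by
  let T : Set ↥{u : W | u ≠ v} := {u | Γ.Adj p u.1}
  have himg : Subtype.val '' T = Γ.neighborSet p \ {v} := by
    ext u
    constructor
    · rintro ⟨u, hu, rfl⟩
      exact ⟨hu, u.2⟩
    · rintro ⟨h1, h2⟩
      exact ⟨⟨u, h2⟩, h1, rfl⟩
  have hcard : Nat.card T = 3 := by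
    have h1 : (Subtype.val '' T).ncard = T.ncard :=
      Set.ncard_image_of_injective T Subtype.val_injective
    have h2 : (Γ.neighborSet p).ncard = 4 := h4 p
    have h3 := Set.ncard_sdiff_singleton_of_mem (show v ∈ Γ.neighborSet p from hadj)
    rw [himg] at h1
    change T.ncard = 3
    omega
  let e := Finite.equivFinOfCardEq hcard
  refine ⟨fun i => (e.symm i).1, Subtype.val_injective.comp e.symm.injective, fun u => ?_⟩
  constructor
  · intro h
    refine ⟨e ⟨u, h⟩, ?_⟩
    simp
  · rintro ⟨i, rfl⟩
    exact (e.symm i).2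

lemma del_count (Γ : SimpleGraph W) (h4 : ∀ w : W, Nat.card (Γ.neighborSet w) = 4)
    (v₁ v₂ v₃ : W) (h12 : v₁ ≠ v₂) (h13 : v₁ ≠ v₃) (h23 : v₂ ≠ v₃) (S : W → Prop)
    (hS1 : ¬ S v₁) (hS2 : ¬ S v₂) (hS3 : ¬ S v₃)
    (hS : ∀ u w, Γ.Adj u w → S u → S w ∨ w = v₁ ∨ w = v₂ ∨ w = v₃)
    (p : W) (hp : S p) (hpv : Γ.Adj v₁ p)
    (p' : W) (hp' : ¬ S p') (hp2 : p' ≠ v₂) (hp3 : p' ≠ v₃)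
    (hpv' : Γ.Adj v₁ p') (K : Type) [Field K] [Fintype K] :
    (Fintype.card K) ^ 3 ∣ Xcount (delVert Γ v₁) K := by
  obtain ⟨f, hf, hfp⟩ := three_nbrs Γ h4 v₁ p hpv.ne.symm hpv.symm
  obtain ⟨f', hf', hfp'⟩ := three_nbrs Γ h4 v₁ p' hpv'.ne.symm hpv'.symm
  refine graph_count (delVert Γ v₁) K ⟨v₂, h12.symm⟩ ⟨v₃, h13.symm⟩
    (fun h => h23 (congrArg Subtype.val h)) (fun u => S u.1) hS2 hS3 ?_
    ⟨p, hpv.ne.symm⟩ hp f hf hfp ⟨p', hpv'.ne.symm⟩ hp'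
    (fun h => hp2 (congrArg Subtype.val h)) (fun h => hp3 (congrArg Subtype.val h)) f' hf' hfp'
  rintro ⟨u, hu⟩ ⟨w, hw⟩ h hSu
  rcases hS u w h hSu with h1 | h1 | h1 | h1
  · exact Or.inl h1
  · exact absurd h1 hw
  · exact Or.inr (Or.inl (Subtype.ext h1))
  · exact Or.inr (Or.inr (Subtype.ext h1))

lemma pigeon3 (a b c d e f : Prop) (h1 : a ∨ b) (h2 : a ∨ c) (h3 : b ∨ c) (h4 : d ∨ e)
    (h5 : d ∨ f) (h6 : e ∨ f) (h7 : ¬ (a ∧ d)) (h8 : ¬ (b ∧ e)) (h9 : ¬ (c ∧ f)) : False := by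
  tauto

lemma exists_good (Γ : SimpleGraph W) (hΓ : IsCompletedPrimitive Γ) (hred : IsReducible Γ)
    (K : Type) [Field K] [Fintype K] :
    ∃ v, (Fintype.card K) ^ 3 ∣ Xcount (delVert Γ v) K := by
  obtain ⟨v₁, v₂, v₃, h12, h13, h23, hnc⟩ := hred
  set U : Set W := {u : W | u ≠ v₁ ∧ u ≠ v₂ ∧ u ≠ v₃} with hU
  set H := SimpleGraph.induce U Γ with hH
  have hne : Nonempty U := by
    by_contra hno
    have hsub : (Finset.univ : Finset W) ⊆ {v₁, v₂, v₃} := by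
      intro u _
      by_contra hu
      simp only [Finset.mem_insert, Finset.mem_singleton, not_or] at hu
      exact hno ⟨⟨u, hu⟩⟩
    have h1 := Finset.card_le_card hsub
    have h2 : ({v₁, v₂, v₃} : Finset W).card ≤ 3 := Finset.card_le_three
    have h3 := hΓ.2.2.1
    rw [Finset.card_univ] at h1
    omega
  have hnp : ¬ H.Preconnected := fun h => hnc ⟨h⟩
  rw [SimpleGraph.Preconnected] at hnp
  push Not at hnp
  obtain ⟨x, y, hxy⟩ := hnp
  let S : W → Prop := fun u => ∃ h : u ∈ U, H.Reachable x ⟨u, h⟩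
  let S' : W → Prop := fun u => u ∈ U ∧ ¬ S u
  have hxS : S x.1 := ⟨x.2, SimpleGraph.Reachable.refl _⟩
  have hyS : S' y.1 := ⟨y.2, fun ⟨_, h⟩ => hxy h⟩
  have hSU : ∀ u, S u → u ∈ U := fun u h => h.1
  have hcl : ∀ u w, Γ.Adj u w → S u → w ∈ U → S w := by
    rintro u w h ⟨hu, hr⟩ hw
    refine ⟨hw, hr.trans (SimpleGraph.Adj.reachable ?_)⟩
    exact h
  have hcl' : ∀ u w, Γ.Adj u w → S' u → w ∈ U → S' w := by
    rintro u w h ⟨hu, hr⟩ hw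
    exact ⟨hw, fun hwS => hr (hcl w u h.symm hwS hu)⟩
  have n1 : v₁ ∉ U := fun h => h.1 rfl
  have n2 : v₂ ∉ U := fun h => h.2.1 rfl
  have n3 : v₃ ∉ U := fun h => h.2.2 rfl
  have hnU : ∀ w, w ∉ U → w = v₁ ∨ w = v₂ ∨ w = v₃ := by
    intro w hw
    by_contra h
    rw [not_or, not_or] at h
    exact hw h
  have two : ∀ T : W → Prop, (∀ u, T u → u ∈ U) → (∀ u w, Γ.Adj u w → T u → w ∈ U → T w) →
      (∃ u, T u) → ∀ a b c, a ≠ c → a ∉ U → c ∉ U →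
      (∀ w, w ∉ U → w = a ∨ w = b ∨ w = c) →
      (∃ u, T u ∧ Γ.Adj a u) ∨ (∃ u, T u ∧ Γ.Adj b u) := by
    rintro T hTU hT ⟨u0, hu0⟩ a b c hac ha hc hall
    by_contra hcon
    rw [not_or] at hcon
    obtain ⟨c1, c2⟩ := hcon
    refine one_exit Γ hΓ T c (fun h => hc (hTU _ h)) ?_ u0 hu0 a (fun h => ha (hTU _ h)) hac
    intro u w h hu
    by_cases hw : w ∈ U
    · exact Or.inl (hT u w h hu hw)
    · rcases hall w hw with rfl | rfl | rfl
      · exact absurd ⟨u, hu, h.symm⟩ c1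
      · exact absurd ⟨u, hu, h.symm⟩ c2
      · exact Or.inr rfl
  have q1 := two S hSU hcl ⟨_, hxS⟩
  have q2 := two S' (fun u h => h.1) hcl' ⟨_, hyS⟩
  have a12 := q1 v₁ v₂ v₃ h13 n1 n3 hnU
  have a13 := q1 v₁ v₃ v₂ h12 n1 n2 (fun w hw => by rcases hnU w hw with h | h | h <;> simp [h])
  have a23 := q1 v₂ v₃ v₁ h12.symm n2 n1 (fun w hw => by rcases hnU w hw with h | h | h <;> simp [h])
  have b12 := q2 v₁ v₂ v₃ h13 n1 n3 hnU
  have b13 := q2 v₁ v₃ v₂ h12 n1 n2 (fun w hw => by rcases hnU w hw with h | h | h <;> simp [h])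
  have b23 := q2 v₂ v₃ v₁ h12.symm n2 n1 (fun w hw => by rcases hnU w hw with h | h | h <;> simp [h])
  have hfin : ∀ a b c, a ≠ b → a ≠ c → b ≠ c → a ∉ U → b ∉ U → c ∉ U →
      (∀ w, w ∉ U → w = a ∨ w = b ∨ w = c) → (∃ u, S u ∧ Γ.Adj a u) →
      (∃ u, S' u ∧ Γ.Adj a u) → ∃ v, (Fintype.card K) ^ 3 ∣ Xcount (delVert Γ v) K := by
    rintro a b c hab hac hbc ha hb hc hall ⟨p, hp, hpa⟩ ⟨p', hp', hpa'⟩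
    refine ⟨a, del_count Γ hΓ.2.1 a b c hab hac hbc S (fun h => ha (hSU _ h))
      (fun h => hb (hSU _ h)) (fun h => hc (hSU _ h)) ?_ p hp hpa p' hp'.2 ?_ ?_ hpa' K⟩
    · intro u w h hu
      by_cases hw : w ∈ U
      · exact Or.inl (hcl u w h hu hw)
      · exact Or.inr (hall w hw)
    · rintro rfl; exact hb hp'.1
    · rintro rfl; exact hc hp'.1
  have g1 := hfin v₁ v₂ v₃ h12 h13 h23 n1 n2 n3 hnU
  have g2 := hfin v₂ v₁ v₃ h12.symm h23 h13 n2 n1 n3 (fun w hw => by rcases hnU w hw with h | h | h <;> simp [h])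
  have g3 := hfin v₃ v₁ v₂ h13.symm h23.symm h12 n3 n1 n2
    (fun w hw => by rcases hnU w hw with h | h | h <;> simp [h])
  by_cases c1 : (∃ u, S u ∧ Γ.Adj v₁ u) ∧ (∃ u, S' u ∧ Γ.Adj v₁ u)
  · exact g1 c1.1 c1.2
  by_cases c2 : (∃ u, S u ∧ Γ.Adj v₂ u) ∧ (∃ u, S' u ∧ Γ.Adj v₂ u)
  · exact g2 c2.1 c2.2
  by_cases c3 : (∃ u, S u ∧ Γ.Adj v₃ u) ∧ (∃ u, S' u ∧ Γ.Adj v₃ u)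
  · exact g3 c3.1 c3.2
  exfalso
  exact pigeon3 _ _ _ _ _ _ a12 a13 a23 b12 b13 b23 c1 c2 c3

end Combinatorics

theorem stmt6 (hCC : CompletionConjecture) {W : Type} [Fintype W] (Γ : SimpleGraph W)
    (hΓ : IsCompletedPrimitive Γ) (hred : IsReducible Γ) (v : W)
    (K : Type) [Field K] [Fintype K] :
    Xcount (delVert Γ v) K ≡ 0 [MOD (Fintype.card K) ^ 3] := by
  obtain ⟨w, hw⟩ := exists_good Γ hΓ hred K
  exact (hCC W Γ hΓ v w K).trans ((Nat.modEq_zero_iff_dvd).2 hw)
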